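/- arXiv:2505.03663 — 6 statements merged into one kernel-verified Lean document; each statement's English description precedes it below -/
import Mathlib

section
/- Let α ∈ (0,1), let β₀, β₁ ∈ ℝ satisfy β₀·β₁ ≥ 0 and β₁ ≠ 0, and let κ ∈ (0,1). Then there exist constants C > 0 and ρ ∈ (0,1) such that for every T > 0, every τ ∈ (0,T), and every classical solution u of the degenerate Robin problem on (0,1)×(0,T), the observability estimate at one point in time holds: (∫₀¹ u(x,T)² dx)^{1/2} ≤ ( e^{C(1 + 1/(T−τ))} · (∫₀^κ u(x,T)² dx)^{1/2} )^ρ · (∫₀¹ u(x,0)² dx)^{(1−ρ)/2·2}, i.e. ‖u(·,T)‖_{L²(0,1)} ≤ ( e^{C(1+1/(T−τ))} ‖u(·,T)‖_{L²(0,κ)} )^ρ · ‖u(·,0)‖_{L²(0,1)}^{1−ρ}. -/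
open MeasureTheory Set

/-- A classical solution of the degenerate Robin problem on `(0,1) × (0,T)`:
`u` is the solution and `v` is the continuous extension of `x ↦ x^α ∂ₓ u`. -/
structure IsDegRobinSol (α β₀ β₁ T : ℝ) (u v : ℝ → ℝ → ℝ) : Prop where
  cont_u : ContinuousOn (fun p : ℝ × ℝ => u p.1 p.2) (Icc 0 1 ×ˢ Icc 0 T)
  contDiff_x : ∀ t ∈ Icc (0:ℝ) T, ContDiffOn ℝ 2 (fun x => u x t) (Ioo 0 1)
  diff_t : ∀ x ∈ Ioo (0:ℝ) 1, ∀ t ∈ Ioo (0:ℝ) T, DifferentiableAt ℝ (fun s => u x s) t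
  cont_ut : ContinuousOn (fun p : ℝ × ℝ => deriv (fun s => u p.1 s) p.2)
      (Ioo 0 1 ×ˢ Ioo 0 T)
  cont_v : ContinuousOn (fun p : ℝ × ℝ => v p.1 p.2) (Icc 0 1 ×ˢ Icc 0 T)
  v_eq : ∀ t ∈ Icc (0:ℝ) T, ∀ x ∈ Ioo (0:ℝ) 1, v x t = x ^ α * deriv (fun y => u y t) x
  diff_v : ∀ t ∈ Icc (0:ℝ) T, ∀ x ∈ Ioo (0:ℝ) 1, DifferentiableAt ℝ (fun y => v y t) x
  pde : ∀ x ∈ Ioo (0:ℝ) 1, ∀ t ∈ Ioo (0:ℝ) T,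
      deriv (fun s => u x s) t = deriv (fun y => v y t) x
  robin : ∀ t ∈ Icc (0:ℝ) T, β₀ * u 0 t = β₁ * v 0 t
  dirichlet : ∀ t ∈ Icc (0:ℝ) T, u 1 t = 0
  int_u : ∀ t ∈ Icc (0:ℝ) T, IntegrableOn (fun x => (u x t) ^ 2) (Ioo 0 1)
  int_ux : ∀ t ∈ Icc (0:ℝ) T,
      IntegrableOn (fun x => x ^ α * (deriv (fun y => u y t) x) ^ 2) (Ioo 0 1)
  deriv_energy : ∀ t ∈ Ioo (0:ℝ) T,
      HasDerivAt (fun s => ∫ x in Ioo (0:ℝ) 1, (u x s) ^ 2)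
        (∫ x in Ioo (0:ℝ) 1, 2 * u x t * deriv (fun s => u x s) t) t

namespace DegRobin

lemma clm_apply_deriv {H : Type*} [NormedAddCommGroup H] [InnerProductSpace ℂ H] 
    (c : ℝ → H →L[ℂ] H) (c' : H →L[ℂ] H) (w : ℝ → H) (w' : H) (t : ℝ)
    (hc : HasDerivAt c c' t) (hw : HasDerivAt w w' t) :
    HasDerivAt (fun s => c s (w s)) (c' (w t) + c t w') t := by
  have h := ((isBoundedBilinearMap_apply (𝕜 := ℂ) (E := H) (F := H)).hasFDerivAt
    (c t, w t)).restrictScalars ℝ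
  have h2 := h.comp_hasDerivAt t (hc.prodMk hw)
  refine h2.congr_deriv ?_
  simp [add_comm]

lemma exp_cfc {H : Type*} [NormedAddCommGroup H] [InnerProductSpace ℂ H] [CompleteSpace H]
    (G : H →L[ℂ] H) (hsa : IsSelfAdjoint G) (iv : ℝ → ℝ) (civ : Continuous iv) (t : ℝ) :
    NormedSpace.exp (t • cfc iv G) = cfc (fun s => Real.exp (t * iv s)) G := by
  have : t • cfc iv G = cfc (fun s => t * iv s) G := by
    rw [← cfc_smul t iv G]; rfl
  have hs : IsSelfAdjoint (t • cfc iv G) := by rw [this]; exact cfc_predicate _ _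
  rw [← CFC.real_exp_eq_normedSpace_exp hs, this, ← cfc_comp' Real.exp (fun s => t * iv s) G]

set_option maxHeartbeats 1000000 in
lemma semigroup_aux {H : Type*} [NormedAddCommGroup H] [InnerProductSpace ℂ H] [CompleteSpace H]
    (G : H →L[ℂ] H) (hG : 0 ≤ G) (T : ℝ) (hT : 0 < T) (u : ℝ → H)
    (hu : ContinuousOn u (Icc 0 T))
    (hd : ∀ t ∈ Ioo (0:ℝ) T, HasDerivAt (fun s => G (u s)) (-u t) t) (ε : ℝ) (hε : 0 < ε) :
    cfc (fun s : ℝ => max (s - ε) 0) G (u T) =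
      cfc (fun s : ℝ => max (s - ε) 0) G (cfc (fun s : ℝ => expNegInvGlue (s / T)) G (u 0)) := by
  have hsa : IsSelfAdjoint G := IsSelfAdjoint.of_nonneg hG
  set χ : ℝ → ℝ := fun s => max (s - ε) 0 with hχ
  set iv : ℝ → ℝ := fun s => (max s ε)⁻¹ with hiv
  have hmax : ∀ s : ℝ, 0 < max s ε := fun s => lt_of_lt_of_le hε (le_max_right _ _)
  have cχ : Continuous χ := by fun_prop
  have civ : Continuous iv := by
    refine Continuous.inv₀ (by fun_prop) (fun s => (hmax s).ne')
  have hgl : Continuous (fun s : ℝ => expNegInvGlue (s / T)) := by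
    have : Continuous expNegInvGlue := (expNegInvGlue.contDiff (n := 0)).continuous
    fun_prop
  set A := cfc iv G with hA
  set X := cfc χ G with hX
  have hAsa : IsSelfAdjoint A := cfc_predicate _ _
  have hXA : X = A * X * G := by
    rw [hA, hX, ← cfc_mul iv χ G civ.continuousOn cχ.continuousOn]
    conv_rhs => enter [2]; rw [← cfc_id ℝ G]
    rw [← cfc_mul (fun x => iv x * χ x) id G (civ.mul cχ).continuousOn continuous_id.continuousOn]
    congr 1
    ext s
    simp only [hχ, hiv, id]
    rcases le_total s ε with h | h
    · rw [max_eq_right (sub_nonpos.2 h)]; simp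
    · rw [max_eq_left h]; field_simp [(lt_of_lt_of_le hε h).ne']
  set E : ℝ → H →L[ℂ] H := fun t => NormedSpace.exp (t • A) with hE
  have dE : ∀ t, HasDerivAt E (E t * A) t := fun t => hasDerivAt_exp_smul_const (𝕂 := ℝ) A t
  set h : ℝ → H := fun t => E t (X (u t)) with hh
  have ch : ContinuousOn h (Icc 0 T) := by
    have cE : Continuous E := continuous_iff_continuousAt.2 fun t => (dE t).continuousAt
    exact cE.continuousOn.clm_apply (X.continuous.comp_continuousOn hu)
  have dX : ∀ t ∈ Ioo (0:ℝ) T, HasDerivAt (fun s => X (u s)) (-(A (X (u t)))) t := by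
    intro t ht
    have h1 := (hd t ht)
    have h2 := (((A * X).restrictScalars ℝ).hasFDerivAt).comp_hasDerivAt t h1
    have e : (fun s => X (u s)) = fun s => (A * X) (G (u s)) := by
      ext s
      conv_lhs => rw [hXA]
      rfl
    rw [e]
    refine h2.congr_deriv ?_
    simp
  have dh : ∀ t ∈ Ioo (0:ℝ) T, HasDerivAt h 0 t := by
    intro t ht
    refine (clm_apply_deriv E _ _ _ t (dE t) (dX t ht)).congr_deriv ?_
    simp
  have hconst : h T = h 0 := by
    by_contra hne
    set φ := h T - h 0 with hφ
    have hφ0 : φ ≠ 0 := sub_ne_zero.2 hne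
    let l : H →L[ℝ] ℝ := Complex.reCLM.comp ((innerSL ℂ φ).restrictScalars ℝ)
    obtain ⟨c, hc, hc2⟩ := exists_hasDerivAt_eq_slope (fun t => l (h t)) (fun _ => 0) hT
      (l.continuous.comp_continuousOn ch)
      (fun t ht => (l.hasFDerivAt.comp_hasDerivAt t (dh t ht)).congr_deriv (by simp))
    have h3 : l (h T) - l (h 0) = 0 := by
      have : T - 0 ≠ 0 := by simpa using hT.ne'
      field_simp at hc2
      linarith
    rw [← map_sub, ← hφ] at h3
    have : l φ = ‖φ‖^2 := by
      simp [l, ← inner_self_eq_norm_sq (𝕜 := ℂ)]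
    rw [this] at h3
    exact hφ0 (by simpa using h3)
  have hE0 : E 0 = 1 := by simp [hE]
  have hEe : ∀ t, E t = cfc (fun s => Real.exp (t * iv s)) G := fun t => exp_cfc G hsa iv civ t
  have cexp : ∀ t, Continuous (fun s => Real.exp (t * iv s)) :=
    fun t => Real.continuous_exp.comp (continuous_const.mul civ)
  have hmul : E (-T) * E T = 1 := by
    rw [hEe, hEe, ← cfc_mul _ _ G (cexp _).continuousOn (cexp _).continuousOn]
    have : (fun s => Real.exp (-T * iv s) * Real.exp (T * iv s)) = fun _ => 1 := by
      ext s; rw [← Real.exp_add]; simp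
    rw [this, cfc_const_one ℝ G]
  have h4 : X (u T) = E (-T) (X (u 0)) := by
    have : h T = X (u 0) := by rw [hconst]; simp [hh, hE0]
    rw [← this]
    have := congrArg (fun (L : H →L[ℂ] H) => L (X (u T))) hmul
    simpa [hh] using this.symm
  rw [h4]
  have : E (-T) * X = X * cfc (fun s : ℝ => expNegInvGlue (s / T)) G := by
    rw [hEe, hX, ← cfc_mul _ _ G (cexp _).continuousOn cχ.continuousOn,
      ← cfc_mul _ _ G cχ.continuousOn hgl.continuousOn]
    congr 1
    ext s
    simp only [hχ, hiv]
    rcases le_or_gt s ε with h | h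
    · rw [max_eq_right (sub_nonpos.2 h)]; simp
    · have hs : 0 < s := hε.trans h
      rw [max_eq_left h.le, mul_comm]
      congr 1
      rw [expNegInvGlue, if_neg (not_le.2 (by positivity))]
      congr 1
      field_simp
  have := congrArg (fun (L : H →L[ℂ] H) => L (u 0)) this
  simpa using this

lemma semigroup {H : Type*} [NormedAddCommGroup H] [InnerProductSpace ℂ H] [CompleteSpace H]
    (G : H →L[ℂ] H) (hG : 0 ≤ G) (hinj : ∀ x, G x = 0 → x = 0)
    (T : ℝ) (hT : 0 < T) (u : ℝ → H)
    (hu : ContinuousOn u (Icc 0 T))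
    (hd : ∀ t ∈ Ioo (0:ℝ) T, HasDerivAt (fun s => G (u s)) (-u t) t) :
    ∃ y : ℕ → H, y 0 = u T ∧ (∀ k, G (y (k+1)) = y k) ∧
      ∀ k, ‖y k‖ ≤ (k.factorial : ℝ) / T ^ k * ‖u 0‖ := by
  have hsa : IsSelfAdjoint G := IsSelfAdjoint.of_nonneg hG
  have hgl : Continuous (fun s : ℝ => expNegInvGlue (s / T)) := by
    have : Continuous expNegInvGlue := (expNegInvGlue.contDiff (n := 0)).continuous
    fun_prop
  have key : u T = cfc (fun s : ℝ => expNegInvGlue (s / T)) G (u 0) := by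
    rw [← sub_eq_zero]
    set x := u T - cfc (fun s : ℝ => expNegInvGlue (s / T)) G (u 0) with hx
    apply hinj
    have hb : ∀ ε > 0, ‖G x‖ ≤ ε * ‖x‖ := by
      intro ε hε
      have h1 := semigroup_aux G hG T hT u hu hd ε hε
      have h2 : cfc (fun s : ℝ => max (s - ε) 0) G x = 0 := by
        rw [hx, map_sub, h1, sub_self]
      have h3 : G x = cfc (fun s : ℝ => s - max (s - ε) 0) G x := by
        rw [cfc_sub (fun s : ℝ => s) (fun s => max (s - ε) 0) G, cfc_id' ℝ G]
        simp [h2]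
      rw [h3]
      refine ContinuousLinearMap.le_of_opNorm_le _ (norm_cfc_le hε.le ?_) _
      intro s hs
      have hs0 : 0 ≤ s := spectrum_nonneg_of_nonneg hG hs
      rw [Real.norm_eq_abs, abs_le]
      rcases le_total (s - ε) 0 with h | h
      · rw [max_eq_right h]; constructor <;> linarith
      · rw [max_eq_left h]; constructor <;> linarith
    have : ‖G x‖ ≤ 0 := by
      refine le_of_forall_pos_le_add fun δ hδ => ?_
      have := hb (δ / (‖x‖ + 1)) (by positivity)
      refine this.trans ?_
      rw [zero_add, div_mul_eq_mul_div, div_le_iff₀ (by positivity)]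
      nlinarith [norm_nonneg x]
    simpa using this
  have hf : ∀ k : ℕ, Continuous (fun s : ℝ => (T ^ k)⁻¹ * ((s / T)⁻¹ ^ k * expNegInvGlue (s / T))) := by
    intro k
    have h1 := expNegInvGlue.continuous_polynomial_eval_inv_mul (Polynomial.X ^ k)
    have h2 : Continuous (fun s : ℝ => s / T) := by fun_prop
    have h3 := h1.comp h2
    simp only [Polynomial.eval_pow, Polynomial.eval_X] at h3
    exact continuous_const.mul h3
  refine ⟨fun k => cfc (fun s : ℝ => (T ^ k)⁻¹ * ((s / T)⁻¹ ^ k * expNegInvGlue (s / T))) G (u 0),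
    ?_, ?_, ?_⟩
  · rw [key]; simp
  · intro k
    have : G * cfc (fun s : ℝ => (T ^ (k+1))⁻¹ * ((s / T)⁻¹ ^ (k+1) * expNegInvGlue (s / T))) G
        = cfc (fun s : ℝ => (T ^ k)⁻¹ * ((s / T)⁻¹ ^ k * expNegInvGlue (s / T))) G := by
      conv_lhs => enter [1]; rw [← cfc_id ℝ G]
      rw [← cfc_mul _ _ G (by fun_prop) (hf _).continuousOn]
      congr 1
      ext s
      rcases le_or_gt s 0 with h | h
      · have : s / T ≤ 0 := div_nonpos_of_nonpos_of_nonneg h hT.le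
        simp [expNegInvGlue.zero_of_nonpos this]
      · simp only [id]
        have h1 : s * (s / T)⁻¹ = T := by field_simp
        rw [pow_succ, pow_succ, mul_inv]
        calc _ = (s * (s / T)⁻¹) * T⁻¹ * ((T ^ k)⁻¹ * ((s / T)⁻¹ ^ k * expNegInvGlue (s / T))) := by ring
          _ = _ := by rw [h1, mul_inv_cancel₀ hT.ne', one_mul]
    have := congrArg (fun (L : H →L[ℂ] H) => L (u 0)) this
    simpa using this
  · intro k
    refine ContinuousLinearMap.le_of_opNorm_le _ (norm_cfc_le (by positivity) ?_) _
    intro s hs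
    rcases le_or_gt s 0 with h | h
    · have : s / T ≤ 0 := div_nonpos_of_nonpos_of_nonneg h hT.le
      rw [expNegInvGlue.zero_of_nonpos this]
      simp; positivity
    · have hz : 0 < s / T := by positivity
      rw [expNegInvGlue, if_neg (not_le.2 hz)]
      set z := (s / T)⁻¹ with hzdef
      have hz' : 0 < z := by positivity
      rw [Real.norm_of_nonneg (by positivity), div_eq_inv_mul]
      refine mul_le_mul_of_nonneg_left ?_ (by positivity)
      have := Real.pow_div_factorial_le_exp z hz'.le k
      rw [div_le_iff₀ (by positivity)] at this
      rw [Real.exp_neg, ← div_eq_mul_inv, div_le_iff₀ (Real.exp_pos _)]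
      linarith

end DegRobin

namespace DegRobin

noncomputable def Fint (f : ℝ → ℂ) (y : ℝ) : ℂ := ∫ z in (0:ℝ)..y, f z

noncomputable def Nop (α : ℝ) (f : ℝ → ℂ) (x : ℝ) : ℂ :=
  ∫ y in (0:ℝ)..x, ((y ^ (-α) : ℝ) : ℂ) * Fint f y

section
variable {α : ℝ} 

lemma ii_sub {E : Type*} [NormedAddCommGroup E] {f : ℝ → E} (hf : IntervalIntegrable f volume 0 1) {y : ℝ}
    (hy : y ∈ Icc (0:ℝ) 1) : IntervalIntegrable f volume 0 y := by
  refine hf.mono_set ?_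
  rw [uIcc_of_le hy.1, uIcc_of_le zero_le_one]
  exact Icc_subset_Icc le_rfl hy.2

lemma Fint_cont {f : ℝ → ℂ} (hf : IntervalIntegrable f volume 0 1) :
    ContinuousOn (Fint f) (Icc 0 1) := by
  have := intervalIntegral.continuousOn_primitive_interval' (μ := volume) (a := 0) hf (by simp)
  rwa [uIcc_of_le zero_le_one] at this

lemma Fint_bound {f : ℝ → ℂ} (hf : IntervalIntegrable f volume 0 1) {y : ℝ}
    (hy : y ∈ Icc (0:ℝ) 1) : ‖Fint f y‖ ≤ ∫ z in (0:ℝ)..1, ‖f z‖ := by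
  refine (intervalIntegral.norm_integral_le_integral_norm hy.1).trans ?_
  exact intervalIntegral.integral_mono_interval le_rfl hy.1 hy.2
    (Filter.Eventually.of_forall fun _ => norm_nonneg _) hf.norm

lemma N_ii1 (hα : α < 1) {f : ℝ → ℂ} (hf : IntervalIntegrable f volume 0 1) :
    IntervalIntegrable (fun y => ((y ^ (-α) : ℝ) : ℂ) * Fint f y) volume 0 1 := by
  have h1 : IntervalIntegrable (fun y : ℝ => y ^ (-α)) volume 0 1 :=
    intervalIntegral.intervalIntegrable_rpow' (by linarith)
  have h2 : IntervalIntegrable (fun y : ℝ => ((y ^ (-α) : ℝ) : ℂ)) volume 0 1 :=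
    ⟨h1.1.ofReal, h1.2.ofReal⟩
  refine h2.mul_continuousOn ?_
  rw [uIcc_of_le zero_le_one]
  exact Fint_cont hf

lemma N_cont (hα : α < 1) {f : ℝ → ℂ} (hf : IntervalIntegrable f volume 0 1) :
    ContinuousOn (Nop α f) (Icc 0 1) := by
  have := intervalIntegral.continuousOn_primitive_interval' (μ := volume) (a := 0) (N_ii1 hα hf)
    (by simp)
  rwa [uIcc_of_le zero_le_one] at this

lemma int_rpow0 (p : ℝ) (hp : -1 < p) (y : ℝ) :
    ∫ z in (0:ℝ)..y, z ^ p = y ^ (p + 1) / (p + 1) := by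
  rw [integral_rpow (Or.inl hp), Real.zero_rpow (by linarith), sub_zero]

lemma N_bound (hα : α < 1) {f : ℝ → ℂ} (hf : IntervalIntegrable f volume 0 1) {x : ℝ}
    (hx : x ∈ Icc (0:ℝ) 1) : ‖Nop α f x‖ ≤ (∫ z in (0:ℝ)..1, ‖f z‖) / (1 - α) := by
  set I := ∫ z in (0:ℝ)..1, ‖f z‖
  have hI : 0 ≤ I := intervalIntegral.integral_nonneg zero_le_one fun _ _ => norm_nonneg _
  have h1 : ‖Nop α f x‖ ≤ ∫ y in (0:ℝ)..x, y ^ (-α) * I := by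
    refine intervalIntegral.norm_integral_le_of_norm_le hx.1 ?_ ?_
    · refine Filter.Eventually.of_forall fun y hy => ?_
      rw [norm_mul, Complex.norm_real, Real.norm_of_nonneg (Real.rpow_nonneg hy.1.le _)]
      exact mul_le_mul_of_nonneg_left (Fint_bound hf ⟨hy.1.le, hy.2.trans hx.2⟩)
        (Real.rpow_nonneg hy.1.le _)
    · exact (intervalIntegral.intervalIntegrable_rpow' (by linarith)).mul_const _
  refine h1.trans ?_
  rw [intervalIntegral.integral_mul_const, int_rpow0 _ (by linarith), neg_add_eq_sub,
    div_mul_eq_mul_div]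
  gcongr
  · have : x ^ (1 - α) ≤ 1 := Real.rpow_le_one hx.1 hx.2 (by linarith)
    nlinarith

lemma Fint_congr {f g : ℝ → ℂ} (h : ∀ᵐ z ∂(volume.restrict (Ioc (0:ℝ) 1)), f z = g z)
    {y : ℝ} (hy : y ∈ Icc (0:ℝ) 1) : Fint f y = Fint g y := by
  refine intervalIntegral.integral_congr_ae ?_
  rw [ae_restrict_iff' measurableSet_Ioc] at h
  filter_upwards [h] with z hz hz2
  rw [uIoc_of_le hy.1] at hz2
  exact hz ⟨hz2.1, hz2.2.trans hy.2⟩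

lemma N_congr {f g : ℝ → ℂ} (h : ∀ᵐ z ∂(volume.restrict (Ioc (0:ℝ) 1)), f z = g z)
    {x : ℝ} (hx : x ∈ Icc (0:ℝ) 1) : Nop α f x = Nop α g x := by
  refine intervalIntegral.integral_congr fun y hy => ?_
  rw [uIcc_of_le hx.1] at hy
  simp only [Fint_congr h ⟨hy.1, hy.2.trans hx.2⟩]

lemma N_add (hα : α < 1) {f g : ℝ → ℂ} (hf : IntervalIntegrable f volume 0 1)
    (hg : IntervalIntegrable g volume 0 1) {x : ℝ} (hx : x ∈ Icc (0:ℝ) 1) :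
    Nop α (fun z => f z + g z) x = Nop α f x + Nop α g x := by
  unfold Nop
  rw [← intervalIntegral.integral_add (ii_sub (N_ii1 hα hf) hx) (ii_sub (N_ii1 hα hg) hx)]
  refine intervalIntegral.integral_congr fun y hy => ?_
  rw [uIcc_of_le hx.1] at hy
  have hy' : y ∈ Icc (0:ℝ) 1 := ⟨hy.1, hy.2.trans hx.2⟩
  simp only [Fint]
  rw [intervalIntegral.integral_add (ii_sub hf hy') (ii_sub hg hy')]
  ring

lemma N_smul (c : ℂ) (f : ℝ → ℂ) (x : ℝ) :
    Nop α (fun z => c * f z) x = c * Nop α f x := by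
  unfold Nop Fint
  rw [← intervalIntegral.integral_const_mul]
  congr 1; ext y
  rw [intervalIntegral.integral_const_mul]
  ring

lemma N_zero (x : ℝ) : Nop α (fun _ => 0) x = 0 := by
  simp [Nop, Fint]

lemma N_sum (hα : α < 1) {ι : Type*} (s : Finset ι) (f : ι → ℝ → ℂ) 
    (hf : ∀ i, IntervalIntegrable (f i) volume 0 1) {x : ℝ} (hx : x ∈ Icc (0:ℝ) 1) :
    Nop α (fun z => ∑ i ∈ s, f i z) x = ∑ i ∈ s, Nop α (f i) x := by
  classical
  induction s using Finset.induction_on with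
  | empty => simp [N_zero]
  | insert a s ha ih =>
    simp only [Finset.sum_insert ha]
    have e : (fun z => ∑ i ∈ s, f i z) = ∑ i ∈ s, f i := by ext z; simp
    have hs : IntervalIntegrable (fun z => ∑ i ∈ s, f i z) volume 0 1 := by
      rw [e]; exact IntervalIntegrable.sum s (fun i _ => hf i)
    rw [N_add hα (hf a) hs hx, ih]

lemma int_w (hα : α < 1) (p : ℝ) (hp : 0 ≤ p) {x : ℝ} (hx : 0 ≤ x) :
    ∫ y in (0:ℝ)..x, y ^ (-α) * (y ^ (p + 1) / (p + 1)) =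
      x ^ (p + 2 - α) / ((p + 1) * (p + 2 - α)) := by
  have : ∫ y in (0:ℝ)..x, y ^ (-α) * (y ^ (p + 1) / (p + 1)) =
      ∫ y in (0:ℝ)..x, y ^ (p + 1 - α) / (p + 1) := by
    refine intervalIntegral.integral_congr_ae (Filter.Eventually.of_forall fun y hy => ?_)
    rw [uIoc_of_le hx] at hy
    rw [← mul_div_assoc, ← Real.rpow_add hy.1]
    congr 2; ring
  rw [this, intervalIntegral.integral_div, int_rpow0 _ (by linarith)]
  rw [div_div, mul_comm (p + 1 - α + 1)]
  ring_nf

lemma N_pow (hα : α < 1) (p : ℝ) (hp : 0 ≤ p) {x : ℝ} (hx : 0 ≤ x) :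
    Nop α (fun z => ((z ^ p : ℝ) : ℂ)) x =
      ((x ^ (p + 2 - α) / ((p + 1) * (p + 2 - α)) : ℝ) : ℂ) := by
  rw [← int_w hα p hp hx, ← intervalIntegral.integral_ofReal]
  unfold Nop
  congr 1; ext y
  unfold Fint
  rw [intervalIntegral.integral_ofReal, int_rpow0 _ (by linarith)]
  push_cast; rfl

lemma N_le (hα : α < 1) (p : ℝ) (hp : 0 ≤ p) (f : ℝ → ℂ) (C : ℝ)
    (h : ∀ z ∈ Icc (0:ℝ) 1, ‖f z‖ ≤ C * z ^ p) {x : ℝ} (hx : x ∈ Icc (0:ℝ) 1) :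
    ‖Nop α f x‖ ≤ C * (x ^ (p + 2 - α) / ((p + 1) * (p + 2 - α))) := by
  rw [← int_w hα p hp hx.1, ← intervalIntegral.integral_const_mul]
  refine intervalIntegral.norm_integral_le_of_norm_le hx.1 ?_ ?_
  · refine Filter.Eventually.of_forall fun y hy => ?_
    have hn := Real.rpow_nonneg hy.1.le (-α)
    rw [norm_mul, Complex.norm_real, Real.norm_of_nonneg hn, mul_left_comm]
    refine mul_le_mul_of_nonneg_left ?_ hn
    rw [← int_rpow0 p (by linarith), ← intervalIntegral.integral_const_mul]
    refine intervalIntegral.norm_integral_le_of_norm_le hy.1.le ?_ ?_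
    · exact Filter.Eventually.of_forall fun z hz => h z ⟨hz.1.le, hz.2.trans (hy.2.trans hx.2)⟩
    · exact (intervalIntegral.intervalIntegrable_rpow' (by linarith)).const_mul _
  · refine IntervalIntegrable.const_mul ?_ _
    refine (intervalIntegral.intervalIntegrable_rpow' (by linarith)).mul_continuousOn ?_
    refine ContinuousOn.div_const ?_ _
    exact (Real.continuous_rpow_const (by linarith)).continuousOn

lemma N_deriv (hα : α < 1) {f : ℝ → ℂ} (hf : IntervalIntegrable f volume 0 1) {x : ℝ}
    (hx : x ∈ Ioo (0:ℝ) 1) :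
    HasDerivAt (Nop α f) (((x ^ (-α) : ℝ) : ℂ) * Fint f x) x := by
  have hc : ContinuousOn (fun y => ((y ^ (-α) : ℝ) : ℂ) * Fint f y) (Ioo 0 1) := by
    refine ContinuousOn.mul ?_ ((Fint_cont hf).mono Ioo_subset_Icc_self)
    refine Complex.continuous_ofReal.comp_continuousOn ?_
    exact continuousOn_id.rpow_const fun y hy => Or.inl hy.1.ne'
  refine intervalIntegral.integral_hasDerivAt_right (ii_sub (N_ii1 hα hf) ⟨hx.1.le, hx.2.le⟩) ?_
    (hc.continuousAt (isOpen_Ioo.mem_nhds hx))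
  exact hc.stronglyMeasurableAtFilter isOpen_Ioo x hx

end
end DegRobin

namespace DegRobin

noncomputable abbrev mu : Measure ℝ := volume.restrict (Ioc (0:ℝ) 1)

instance : IsProbabilityMeasure mu := ⟨by simp [mu]⟩

noncomputable def gf (α g : ℝ) (f : ℝ → ℂ) (x : ℝ) : ℂ :=
  Nop α f 1 * (((1 + g * x ^ (1 - α)) / (1 + g) : ℝ) : ℂ) - Nop α f x

section
variable {α g : ℝ} 

lemma gf_cont (hα : α < 1) {f : ℝ → ℂ} (hf : IntervalIntegrable f volume 0 1) :
    ContinuousOn (gf α g f) (Icc 0 1) := by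
  refine ContinuousOn.sub ?_ (N_cont hα hf)
  refine continuousOn_const.mul (Complex.continuous_ofReal.comp_continuousOn ?_)
  have : Continuous (fun x : ℝ => x ^ (1 - α)) := Real.continuous_rpow_const (by linarith)
  fun_prop

lemma gf_bound (hα : α < 1) (hg : 0 ≤ g) {f : ℝ → ℂ} (hf : IntervalIntegrable f volume 0 1) {x : ℝ}
    (hx : x ∈ Icc (0:ℝ) 1) : ‖gf α g f x‖ ≤ 2 / (1 - α) * (∫ z in (0:ℝ)..1, ‖f z‖) := by
  have h1 := N_bound hα hf hx
  have h2 := N_bound hα hf (x := 1) (by simp)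
  have h3 : ‖(((1 + g * x ^ (1 - α)) / (1 + g) : ℝ) : ℂ)‖ ≤ 1 := by
    have : x ^ (1 - α) ≤ 1 := Real.rpow_le_one hx.1 hx.2 (by linarith)
    have h0 : 0 ≤ x ^ (1 - α) := Real.rpow_nonneg hx.1 _
    rw [Complex.norm_real, Real.norm_of_nonneg (by positivity), div_le_one (by positivity)]
    nlinarith
  calc ‖gf α g f x‖ ≤ ‖Nop α f 1 * (((1 + g * x ^ (1 - α)) / (1 + g) : ℝ) : ℂ)‖ + ‖Nop α f x‖ :=
        norm_sub_le _ _
    _ ≤ (∫ z in (0:ℝ)..1, ‖f z‖) / (1 - α) * 1 + (∫ z in (0:ℝ)..1, ‖f z‖) / (1 - α) := by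
        rw [norm_mul]
        exact add_le_add (mul_le_mul h2 h3 (norm_nonneg _) ((norm_nonneg _).trans h2)) h1
    _ = _ := by ring

lemma gf_congr {f h : ℝ → ℂ} (hfh : ∀ᵐ z ∂mu, f z = h z)
    {x : ℝ} (hx : x ∈ Icc (0:ℝ) 1) : gf α g f x = gf α g h x := by
  unfold gf
  rw [N_congr hfh hx, N_congr hfh (x := 1) (by simp)]

lemma gf_add (hα : α < 1) {f h : ℝ → ℂ} (hf : IntervalIntegrable f volume 0 1)
    (hh : IntervalIntegrable h volume 0 1) {x : ℝ} (hx : x ∈ Icc (0:ℝ) 1) :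
    gf α g (fun z => f z + h z) x = gf α g f x + gf α g h x := by
  unfold gf
  rw [N_add hα hf hh hx, N_add hα hf hh (x := 1) (by simp)]
  ring

lemma gf_smul (c : ℂ) (f : ℝ → ℂ) (x : ℝ) :
    gf α g (fun z => c * f z) x = c * gf α g f x := by
  unfold gf
  rw [N_smul, N_smul]; ring

lemma ae_mem : ∀ᵐ z ∂mu, z ∈ Icc (0:ℝ) 1 := by
  filter_upwards [ae_restrict_mem measurableSet_Ioc] with z hz
  exact ⟨hz.1.le, hz.2⟩

lemma memLp_of_cont {f : ℝ → ℂ} (hf : ContinuousOn f (Icc 0 1)) : MemLp f 2 mu := by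
  obtain ⟨C, hC⟩ := isCompact_Icc.exists_bound_of_continuousOn hf
  refine MemLp.of_bound ?_ C ?_
  · exact (hf.mono Ioc_subset_Icc_self).aestronglyMeasurable measurableSet_Ioc
  · filter_upwards [ae_mem] with z hz using hC z hz

lemma ii_of_memLp {f : ℝ → ℂ} (hf : MemLp f 2 mu) : IntervalIntegrable f volume 0 1 := by
  rw [intervalIntegrable_iff_integrableOn_Ioc_of_le zero_le_one]
  exact hf.integrable one_le_two

lemma int_norm_le (f : Lp ℂ 2 mu) : ∫ z in (0:ℝ)..1, ‖f z‖ ≤ ‖f‖ := by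
  rw [intervalIntegral.integral_of_le zero_le_one, integral_norm_eq_lintegral_enorm
    (Lp.aestronglyMeasurable f), ← eLpNorm_one_eq_lintegral_enorm, Lp.norm_def]
  refine ENNReal.toReal_mono (Lp.eLpNorm_ne_top f) ?_
  exact eLpNorm_le_eLpNorm_of_exponent_le one_le_two (Lp.aestronglyMeasurable f)

lemma Lp_ii (f : Lp ℂ 2 mu) : IntervalIntegrable f volume 0 1 := ii_of_memLp (Lp.memLp f)

lemma norm_le_sup {f : Lp ℂ 2 mu} {C : ℝ} (hC : 0 ≤ C) (h : ∀ᵐ z ∂mu, ‖f z‖ ≤ C) : ‖f‖ ≤ C := by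
  have := Lp.norm_le_of_ae_bound hC h
  have e : measureUnivNNReal mu = 1 := by simp [measureUnivNNReal]
  rw [e] at this
  simpa using this

noncomputable def Gop (α g : ℝ) (hα : α < 1) (hg : 0 ≤ g) : Lp ℂ 2 mu →L[ℂ] Lp ℂ 2 mu :=
  LinearMap.mkContinuous
    { toFun := fun f => (memLp_of_cont (gf_cont (g := g) hα (Lp_ii f))).toLp (gf α g f)
      map_add' := by
        intro f h
        rw [← MemLp.toLp_add]
        refine MemLp.toLp_congr _ _ ?_
        filter_upwards [ae_mem] with x hx
        rw [gf_congr (Lp.coeFn_add f h) hx]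
        exact gf_add hα (Lp_ii f) (Lp_ii h) hx
      map_smul' := by
        intro c f
        rw [RingHom.id_apply, ← MemLp.toLp_const_smul]
        refine MemLp.toLp_congr _ _ ?_
        filter_upwards [ae_mem] with x hx
        rw [gf_congr (Lp.coeFn_smul c f) hx]
        exact gf_smul c f x } (2 / (1 - α)) (by
    intro f
    refine norm_le_sup (by have : 0 < 1 - α := by linarith
                           positivity) ?_
    have := (memLp_of_cont (gf_cont (g := g) hα (Lp_ii f))).coeFn_toLp
    filter_upwards [this, ae_mem] with x h1 hx
    simp only [LinearMap.coe_mk, AddHom.coe_mk]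
    rw [h1]
    refine (gf_bound hα hg (Lp_ii f) hx).trans ?_
    have : 0 < 1 - α := by linarith
    have := int_norm_le f
    gcongr)

lemma Gop_coe (hα : α < 1) (hg : 0 ≤ g) (f : Lp ℂ 2 mu) :
    ∀ᵐ x ∂mu, Gop α g hα hg f x = gf α g f x :=
  (memLp_of_cont (gf_cont (g := g) hα (Lp_ii f))).coeFn_toLp

lemma gf_deriv (hα : α < 1) {f : ℝ → ℂ} (hf : IntervalIntegrable f volume 0 1) {x : ℝ}
    (hx : x ∈ Ioo (0:ℝ) 1) :
    HasDerivAt (gf α g f) (((x ^ (-α) : ℝ) : ℂ) * 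
      (Nop α f 1 * ((g * (1 - α) / (1 + g) : ℝ) : ℂ) - Fint f x)) x := by
  have h1 := N_deriv hα hf hx
  have h2 : HasDerivAt (fun x : ℝ => (1 + g * x ^ (1 - α)) / (1 + g))
      (g * ((1 - α) * x ^ (1 - α - 1)) / (1 + g)) x := by
    have := Real.hasDerivAt_rpow_const (x := x) (p := 1 - α) (Or.inl hx.1.ne')
    exact ((this.const_mul g).const_add 1).div_const _
  have h3 := (h2.ofReal_comp.const_mul (Nop α f 1)).sub h1
  refine h3.congr_deriv ?_
  rw [show 1 - α - 1 = -α by ring]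
  push_cast
  ring

lemma pos_aux (hα : α < 1) (hg : 0 ≤ g) {f : ℝ → ℂ} (hf : Continuous f) :
    ∃ r : ℝ, 0 ≤ r ∧ ∫ x in (0:ℝ)..1, star (gf α g f x) * f x = (r : ℂ) := by
  have hii : IntervalIntegrable f volume 0 1 := hf.intervalIntegrable _ _
  set B : ℂ := Nop α f 1 * ((g * (1 - α) / (1 + g) : ℝ) : ℂ) with hB
  have hc1 : ContinuousOn (fun x => star (gf α g f x)) (uIcc 0 1) := by
    rw [uIcc_of_le zero_le_one]; exact (gf_cont hα hii).star
  have hc2 : ContinuousOn (fun x => B - Fint f x) (uIcc 0 1) := by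
    rw [uIcc_of_le zero_le_one]; exact continuousOn_const.sub (Fint_cont hii)
  have hi : IntervalIntegrable (fun x => ((x ^ (-α) : ℝ) : ℂ) * (star (B - Fint f x))) volume 0 1 := by
    have h1 : IntervalIntegrable (fun y : ℝ => y ^ (-α)) volume 0 1 :=
      intervalIntegral.intervalIntegrable_rpow' (by linarith)
    have h2 : IntervalIntegrable (fun y : ℝ => ((y ^ (-α) : ℝ) : ℂ)) volume 0 1 :=
      ⟨h1.1.ofReal, h1.2.ofReal⟩
    exact h2.mul_continuousOn hc2.star
  have key := intervalIntegral.integral_mul_deriv_eq_deriv_mul_of_hasDerivAt hc1 hc2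
    (u' := fun x => ((x ^ (-α) : ℝ) : ℂ) * (star (B - Fint f x))) (v' := fun x => - f x)
    (by
      intro x hx
      rw [min_eq_left zero_le_one, max_eq_right zero_le_one] at hx
      refine (gf_deriv (g := g) hα hii hx).star.congr_deriv ?_
      rw [star_mul', ← hB]
      congr 1
      exact Complex.conj_ofReal _)
    (by
      intro x hx
      refine HasDerivAt.const_sub B ?_
      exact intervalIntegral.integral_hasDerivAt_right (hf.intervalIntegrable _ _)
        (hf.stronglyMeasurableAtFilter _ _) hf.continuousAt)
    hi hii.neg
  have h1 : gf α g f 1 = 0 := by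
    unfold gf
    rw [Real.one_rpow, mul_one, div_self (by positivity)]; simp
  have h0 : gf α g f 0 = Nop α f 1 * ((1 / (1 + g) : ℝ) : ℂ) := by
    unfold gf
    rw [Real.zero_rpow (by linarith)]; simp [Nop]
  have hF0 : Fint f 0 = 0 := by simp [Fint]
  simp only [mul_neg, intervalIntegral.integral_neg] at key
  rw [h1, h0, hF0] at key
  refine ⟨g * (1 - α) * ‖Nop α f 1 * ((1 / (1 + g) : ℝ) : ℂ)‖ ^ 2 +
    ∫ x in (0:ℝ)..1, x ^ (-α) * ‖B - Fint f x‖ ^ 2, ?_, ?_⟩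
  · have : 0 < 1 - α := by linarith
    refine add_nonneg (by positivity) ?_
    exact intervalIntegral.integral_nonneg zero_le_one fun x hx => 
      mul_nonneg (Real.rpow_nonneg hx.1 _) (by positivity)
  · rw [neg_eq_iff_eq_neg] at key
    rw [key]
    push_cast
    rw [← intervalIntegral.integral_ofReal]
    have e1 : ∀ z : ℂ, ((‖z‖ : ℝ) : ℂ) ^ 2 = star z * z := fun z => (Complex.conj_mul' z).symm
    have e2 : ∀ x : ℝ, ((x ^ (-α) * ‖B - Fint f x‖ ^ 2 : ℝ) : ℂ) =
        ((x ^ (-α) : ℝ) : ℂ) * (star (B - Fint f x)) * (B - Fint f x) := by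
      intro x; push_cast; rw [e1]; ring
    simp_rw [e2]
    rw [e1, hB]
    have : ((g * (1 - α) / (1 + g) : ℝ) : ℂ) = (g:ℂ) * (1 - (α:ℂ)) * ((1 / (1 + g) : ℝ) : ℂ) := by
      push_cast; ring
    rw [this]
    push_cast
    simp
    ring

lemma Gop_nonneg (hα : α < 1) (hg : 0 ≤ g) : 0 ≤ Gop α g hα hg := by
  rw [ContinuousLinearMap.nonneg_iff_isPositive, ContinuousLinearMap.isPositive_iff_complex]
  intro x
  have hd := BoundedContinuousFunction.toLp_denseRange (α := ℝ) (p := 2) ℂ mu ℂ (by simp)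
  refine hd.induction_on (p := fun x => ((RCLike.re (inner ℂ (Gop α g hα hg x) x) : ℝ) : ℂ) =
    inner ℂ (Gop α g hα hg x) x ∧ 0 ≤ RCLike.re (inner ℂ (Gop α g hα hg x) x)) x ?_ ?_
  · rw [setOf_and]
    have c : Continuous fun b => inner ℂ (Gop α g hα hg b) b := by fun_prop
    exact IsClosed.inter (isClosed_eq (Complex.continuous_ofReal.comp (Complex.continuous_re.comp c)) c)
      (isClosed_le continuous_const (Complex.continuous_re.comp c))
  · intro f
    set F := BoundedContinuousFunction.toLp 2 mu ℂ f with hF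
    have hFf : ∀ᵐ x ∂mu, F x = f x := BoundedContinuousFunction.coeFn_toLp 2 mu ℂ f
    obtain ⟨r, hr, h⟩ := pos_aux (g := g) hα hg f.continuous
    have : inner ℂ (Gop α g hα hg F) F = (r : ℂ) := by
      rw [L2.inner_def, ← h, intervalIntegral.integral_of_le zero_le_one]
      refine integral_congr_ae ?_
      filter_upwards [Gop_coe hα hg F, hFf, ae_mem] with x h1 h2 hx
      rw [h1, h2, gf_congr hFf hx, RCLike.inner_apply, mul_comm]
      rfl
    rw [this]
    simp [hr]

lemma Gop_inj (hα : α < 1) (hg : 0 ≤ g) (f : Lp ℂ 2 mu) (h : Gop α g hα hg f = 0) : f = 0 := by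
  have h0 : ∀ᵐ x ∂mu, gf α g f x = 0 := by
    have h2 : ∀ᵐ x ∂mu, Gop α g hα hg f x = 0 := by rw [h]; exact Lp.coeFn_zero _ _ _
    filter_upwards [Gop_coe hα hg f, h2] with x h1 h2
    rw [← h1, h2]
  have hii := Lp_ii f
  have h1 : ∀ x ∈ Ioo (0:ℝ) 1, gf α g f x = 0 := by
    have hae : gf α g f =ᵐ[volume.restrict (Ioo (0:ℝ) 1)] fun _ => 0 :=
      ae_restrict_of_ae_restrict_of_subset Ioo_subset_Ioc_self h0
    exact Measure.eqOn_open_of_ae_eq hae isOpen_Ioo ((gf_cont hα hii).mono Ioo_subset_Icc_self)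
      continuousOn_const
  set B : ℂ := Nop α f 1 * ((g * (1 - α) / (1 + g) : ℝ) : ℂ) with hB
  have h2 : ∀ x ∈ Ioo (0:ℝ) 1, Fint f x = B := by
    intro x hx
    have d := gf_deriv (g := g) hα hii hx
    have d0 : HasDerivAt (gf α g f) 0 x := by
      refine (hasDerivAt_const x (0:ℂ)).congr_of_eventuallyEq ?_
      filter_upwards [isOpen_Ioo.mem_nhds hx] with y hy using h1 y hy
    have := d.unique d0
    rcases mul_eq_zero.1 this with h | h
    · exfalso
      exact (Real.rpow_pos_of_pos hx.1 (-α)).ne' (by exact_mod_cast h)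
    · exact (sub_eq_zero.1 h).symm
  have h3 := hii.ae_hasDerivAt_integral
  refine (Lp.eq_zero_iff_ae_eq_zero).2 ?_
  have hne : ∀ᵐ x : ℝ, x ≠ 1 := by simp [ae_iff, measure_singleton]
  filter_upwards [ae_restrict_of_ae h3, ae_restrict_mem measurableSet_Ioc, ae_restrict_of_ae hne]
    with x hx hx2 hx3
  have hx4 : x ∈ Ioo (0:ℝ) 1 := ⟨hx2.1, lt_of_le_of_ne hx2.2 hx3⟩
  have d := hx (by rw [uIcc_of_le zero_le_one]; exact ⟨hx2.1.le, hx2.2⟩) 0 (by simp)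
  have d0 : HasDerivAt (fun x => ∫ t in (0:ℝ)..x, f t) 0 x := by
    refine (hasDerivAt_const x B).congr_of_eventuallyEq ?_
    filter_upwards [isOpen_Ioo.mem_nhds hx4] with y hy using h2 y hy
  exact d.unique d0

end
end DegRobin

namespace DegRobin

lemma leib (φ φ' : ℝ → ℝ → ℝ) (s t : ℝ)
    (hφ' : ContinuousOn (fun p : ℝ × ℝ => φ' p.1 p.2) (Ioo 0 1 ×ˢ uIcc s t))
    (hd : ∀ r ∈ uIcc s t, ∀ x ∈ Ioo (0:ℝ) 1, HasDerivAt (fun y => φ y r) (φ' x r) x)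
    (hc : ∀ x ∈ Ioo (0:ℝ) 1, ContinuousOn (φ x) (uIcc s t)) {x : ℝ} (hx : x ∈ Ioo (0:ℝ) 1) :
    HasDerivAt (fun y => ∫ r in s..t, φ y r) (∫ r in s..t, φ' x r) x := by
  set a := x / 2 with ha
  set b := (x + 1) / 2 with hb
  have hab : x ∈ Ioo a b := ⟨by linarith [hx.1], by linarith [hx.2]⟩
  have hsub : Icc a b ⊆ Ioo (0:ℝ) 1 := fun y hy =>
    ⟨by have := hx.1; linarith [hy.1], by have := hx.2; linarith [hy.2]⟩
  obtain ⟨C, hC⟩ := (isCompact_Icc (a := a) (b := b)).prod (isCompact_uIcc (a := s) (b := t))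
    |>.exists_bound_of_continuousOn (hφ'.mono (prod_mono hsub subset_rfl))
  have hc' : ∀ x ∈ Ioo (0:ℝ) 1, ContinuousOn (φ' x) (uIcc s t) := by
    intro x hx
    refine hφ'.comp (f := fun r => (x, r)) (by fun_prop) fun r hr => ⟨hx, hr⟩
  have := intervalIntegral.hasDerivAt_integral_of_dominated_loc_of_deriv_le (μ := volume)
    (F := φ) (F' := φ') (x₀ := x) (s := Ioo a b) (a := s) (b := t) (bound := fun _ => C)
    (isOpen_Ioo.mem_nhds hab) ?_ ?_ ?_ ?_ ?_ ?_
  · exact this.2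
  · filter_upwards [isOpen_Ioo.mem_nhds hx] with y hy
    exact ((hc y hy).mono uIoc_subset_uIcc).aestronglyMeasurable measurableSet_uIoc
  · exact (hc x hx).intervalIntegrable
  · exact ((hc' x hx).mono uIoc_subset_uIcc).aestronglyMeasurable measurableSet_uIoc
  · refine Filter.Eventually.of_forall fun r hr y hy => ?_
    exact hC (y, r) ⟨Ioo_subset_Icc_self hy, uIoc_subset_uIcc hr⟩
  · exact intervalIntegrable_const
  · refine Filter.Eventually.of_forall fun r hr y hy => ?_
    exact hd r (uIoc_subset_uIcc hr) y (hsub (Ioo_subset_Icc_self hy))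

lemma Wcont (φ : ℝ → ℝ → ℝ) (T s t : ℝ) (hT : 0 < T)
    (hφ : ContinuousOn (fun p : ℝ × ℝ => φ p.1 p.2) (Icc 0 1 ×ˢ Icc 0 T))
    (hst : uIcc s t ⊆ Icc 0 T) : ContinuousOn (fun x => ∫ r in s..t, φ x r) (Icc 0 1) := by
  have hc : Continuous (fun p : ℝ × ℝ => φ (max 0 (min p.1 1)) (max 0 (min p.2 T))) := by
    refine hφ.comp_continuous (f := fun p : ℝ × ℝ => ((max 0 (min p.1 1)), (max 0 (min p.2 T))))
      (by fun_prop) fun p => ?_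
    refine ⟨⟨le_max_left _ _, ?_⟩, ⟨le_max_left _ _, ?_⟩⟩
    · exact max_le zero_le_one (min_le_right _ _)
    · exact max_le hT.le (min_le_right _ _)
  have h2 := intervalIntegral.continuous_parametric_intervalIntegral_of_continuous' (μ := volume)
    (f := fun x r => φ (max 0 (min x 1)) (max 0 (min r T))) hc s t
  refine h2.continuousOn.congr fun x hx => ?_
  refine intervalIntegral.integral_congr fun r hr => ?_
  have hr' := hst hr
  rw [min_eq_left hx.2, max_eq_right hx.1, min_eq_left hr'.2, max_eq_right hr'.1]

lemma repr_aux {α β₀ β₁ T g : ℝ} (hα : α ∈ Ioo (0:ℝ) 1) (hβ₁ : β₁ ≠ 0)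
    (hg : 0 ≤ g) (hgd : g * (1 - α) = β₀ / β₁) (hT : 0 < T)
    {u v : ℝ → ℝ → ℝ} (h : IsDegRobinSol α β₀ β₁ T u v) {s t : ℝ} (hs : s ∈ Ioo 0 T)
    (ht : t ∈ Ioo 0 T) {x : ℝ} (hx : x ∈ Icc (0:ℝ) 1) :
    gf α g (fun z => ((u z t - u z s : ℝ) : ℂ)) x = -((∫ r in s..t, u x r : ℝ) : ℂ) := by
  have hst : uIcc s t ⊆ Ioo 0 T := (ordConnected_Ioo).uIcc_subset hs ht
  have hst' : uIcc s t ⊆ Icc 0 T := hst.trans Ioo_subset_Icc_self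
  have hα1 : 0 < 1 - α := by linarith [hα.2]
  set W : ℝ → ℝ := fun x => ∫ r in s..t, u x r with hW
  set V : ℝ → ℝ := fun x => ∫ r in s..t, v x r with hV
  have cW : ContinuousOn W (Icc 0 1) := Wcont u T s t hT h.cont_u hst'
  have cV : ContinuousOn V (Icc 0 1) := Wcont v T s t hT h.cont_v hst'
  have cux : ∀ x ∈ Icc (0:ℝ) 1, ContinuousOn (u x) (Icc 0 T) := fun x hx =>
    h.cont_u.comp (f := fun r => (x, r)) (by fun_prop) fun r hr => ⟨hx, hr⟩
  have cut : ∀ r ∈ Icc (0:ℝ) T, ContinuousOn (fun x => u x r) (Icc 0 1) := fun r hr =>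
    h.cont_u.comp (f := fun x => (x, r)) (by fun_prop) fun x hx => ⟨hx, hr⟩
  have cvx : ∀ x ∈ Icc (0:ℝ) 1, ContinuousOn (v x) (Icc 0 T) := fun x hx =>
    h.cont_v.comp (f := fun r => (x, r)) (by fun_prop) fun r hr => ⟨hx, hr⟩
  have dW : ∀ x ∈ Ioo (0:ℝ) 1, HasDerivAt W (x ^ (-α) * V x) x := by
    intro x hx
    have := leib u (fun x r => x ^ (-α) * v x r) s t ?_ ?_ ?_ hx
    · refine this.congr_deriv ?_
      rw [intervalIntegral.integral_const_mul]
    · refine ContinuousOn.mul ?_ (h.cont_v.mono (prod_mono Ioo_subset_Icc_self hst'))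
      exact continuousOn_fst.rpow_const fun p hp => Or.inl hp.1.1.ne'
    · intro r hr y hy
      have hd : DifferentiableAt ℝ (fun x => u x r) y :=
        ((h.contDiff_x r (hst' hr)).differentiableOn (by norm_num)).differentiableAt
          (isOpen_Ioo.mem_nhds hy)
      refine hd.hasDerivAt.congr_deriv ?_
      rw [h.v_eq r (hst' hr) y hy, ← mul_assoc, ← Real.rpow_add hy.1]
      simp
    · intro y hy
      exact (cux y (Ioo_subset_Icc_self hy)).mono hst'
  have dV : ∀ x ∈ Ioo (0:ℝ) 1, HasDerivAt V (u x t - u x s) x := by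
    intro x hx
    have := leib v (fun x r => deriv (fun q => u x q) r) s t ?_ ?_ ?_ hx
    · refine this.congr_deriv ?_
      refine intervalIntegral.integral_eq_sub_of_hasDerivAt (f := u x) ?_ ?_
      · intro r hr
        exact (h.diff_t x hx r (hst hr)).hasDerivAt
      · refine ContinuousOn.intervalIntegrable ?_
        exact h.cont_ut.comp (f := fun r => (x, r)) (by fun_prop) fun r hr => ⟨hx, hst hr⟩
    · exact h.cont_ut.mono (prod_mono subset_rfl hst)
    · intro r hr y hy
      rw [h.pde y hy r (hst hr)]
      exact (h.diff_v r (hst' hr) y hy).hasDerivAt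
    · intro y hy
      exact (cvx y (Ioo_subset_Icc_self hy)).mono hst'
  have W1 : W 1 = 0 := by
    simp only [hW]
    rw [intervalIntegral.integral_congr (g := fun _ => 0) fun r hr => h.dirichlet r (hst' hr)]
    simp
  have V0 : V 0 = g * (1 - α) * W 0 := by
    simp only [hW, hV]
    rw [← intervalIntegral.integral_const_mul]
    refine intervalIntegral.integral_congr fun r hr => ?_
    have := h.robin r (hst' hr)
    simp only [hgd]
    field_simp
    linarith
  have cf : ContinuousOn (fun z => u z t - u z s) (Icc 0 1) :=
    (cut t (Ioo_subset_Icc_self ht)).sub (cut s (Ioo_subset_Icc_self hs))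
  have hVf : ∀ y ∈ Icc (0:ℝ) 1, ∫ z in (0:ℝ)..y, (u z t - u z s) = V y - V 0 := by
    intro y hy
    have hsub : Icc 0 y ⊆ Icc (0:ℝ) 1 := Icc_subset_Icc le_rfl hy.2
    refine intervalIntegral.integral_eq_sub_of_hasDerivAt_of_le hy.1 (cV.mono hsub) ?_ ?_
    · intro z hz; exact dV z ⟨hz.1, hz.2.trans_le hy.2⟩
    · refine ContinuousOn.intervalIntegrable ?_
      rw [uIcc_of_le hy.1]; exact cf.mono hsub
  have hi : ∀ y ∈ Icc (0:ℝ) 1, IntervalIntegrable (fun z => z ^ (-α) * V z) volume 0 y := by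
    intro y hy
    refine (intervalIntegral.intervalIntegrable_rpow' (by linarith)).mul_continuousOn ?_
    rw [uIcc_of_le hy.1]
    exact cV.mono (Icc_subset_Icc le_rfl hy.2)
  have hWf : ∀ x ∈ Icc (0:ℝ) 1, ∫ y in (0:ℝ)..x, y ^ (-α) * V y = W x - W 0 := by
    intro y hy
    have hsub : Icc 0 y ⊆ Icc (0:ℝ) 1 := Icc_subset_Icc le_rfl hy.2
    refine intervalIntegral.integral_eq_sub_of_hasDerivAt_of_le hy.1 (cW.mono hsub) ?_ (hi y hy)
    intro z hz; exact dW z ⟨hz.1, hz.2.trans_le hy.2⟩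
  have hN : ∀ x ∈ Icc (0:ℝ) 1, Nop α (fun z => ((u z t - u z s : ℝ) : ℂ)) x =
      ((W x - W 0 - g * W 0 * x ^ (1 - α) : ℝ) : ℂ) := by
    intro x hx
    have e1 : Nop α (fun z => ((u z t - u z s : ℝ) : ℂ)) x =
        ∫ y in (0:ℝ)..x, ((y ^ (-α) * V y - y ^ (-α) * V 0 : ℝ) : ℂ) := by
      refine intervalIntegral.integral_congr fun y hy => ?_
      rw [uIcc_of_le hx.1] at hy
      simp only [Fint]
      rw [intervalIntegral.integral_ofReal, hVf y ⟨hy.1, hy.2.trans hx.2⟩]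
      push_cast; ring
    rw [e1, intervalIntegral.integral_ofReal, intervalIntegral.integral_sub (hi x hx)
      ((intervalIntegral.intervalIntegrable_rpow' (by linarith)).mul_const _),
      intervalIntegral.integral_mul_const, int_rpow0 _ (by linarith), hWf x hx, V0]
    congr 2
    rw [neg_add_eq_sub]
    field_simp
  unfold gf
  rw [hN x hx, hN 1 (by simp), W1, Real.one_rpow, ← Complex.ofReal_mul, ← Complex.ofReal_sub,
    ← Complex.ofReal_neg]
  congr 1
  have : 0 < 1 + g := by positivity
  field_simp
  ring

open Classical in
noncomputable def UU (u : ℝ → ℝ → ℝ) (t : ℝ) : Lp ℂ 2 mu :=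
  if h : MemLp (fun x => ((u x t : ℝ) : ℂ)) 2 mu then h.toLp _ else 0

lemma UU_coe {α β₀ β₁ T : ℝ} {u v : ℝ → ℝ → ℝ} (h : IsDegRobinSol α β₀ β₁ T u v) {t : ℝ}
    (ht : t ∈ Icc 0 T) : ∀ᵐ x ∂mu, UU u t x = ((u x t : ℝ) : ℂ) := by
  have hc : ContinuousOn (fun x => u x t) (Icc 0 1) :=
    h.cont_u.comp (f := fun x => (x, t)) (by fun_prop) fun x hx => ⟨hx, ht⟩
  have hm : MemLp (fun x => ((u x t : ℝ) : ℂ)) 2 mu :=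
    memLp_of_cont (Complex.continuous_ofReal.comp_continuousOn hc)
  unfold UU
  rw [dif_pos hm]
  exact hm.coeFn_toLp

lemma unif {α β₀ β₁ T : ℝ} {u v : ℝ → ℝ → ℝ} (h : IsDegRobinSol α β₀ β₁ T u v) {ε : ℝ}
    (hε : 0 < ε) : ∃ δ > 0, ∀ x ∈ Icc (0:ℝ) 1, ∀ s ∈ Icc 0 T, ∀ t ∈ Icc 0 T, |t - s| < δ →
      |u x t - u x s| ≤ ε := by
  have := (isCompact_Icc.prod isCompact_Icc).uniformContinuousOn_of_continuous h.cont_u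
  rw [Metric.uniformContinuousOn_iff] at this
  obtain ⟨δ, hδ, H⟩ := this ε hε
  refine ⟨δ, hδ, fun x hx s hs t ht hst => ?_⟩
  have := H (x, t) ⟨hx, ht⟩ (x, s) ⟨hx, hs⟩ (by
    rw [Prod.dist_eq]; simpa [Real.dist_eq, hδ] using hst)
  rw [Real.dist_eq] at this
  exact this.le

lemma UU_cont {α β₀ β₁ T : ℝ} {u v : ℝ → ℝ → ℝ} (h : IsDegRobinSol α β₀ β₁ T u v) :
    ContinuousOn (UU u) (Icc 0 T) := by
  rw [Metric.continuousOn_iff]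
  intro s hs ε hε
  obtain ⟨δ, hδ, H⟩ := unif h (half_pos hε)
  refine ⟨δ, hδ, fun t ht hts => ?_⟩
  rw [dist_eq_norm]
  refine lt_of_le_of_lt (norm_le_sup (half_pos hε).le ?_) (half_lt_self hε)
  filter_upwards [UU_coe h hs, UU_coe h ht, Lp.coeFn_sub (UU u t) (UU u s), ae_mem]
    with x h1 h2 h3 hx
  rw [h3, Pi.sub_apply, h1, h2, ← Complex.ofReal_sub, Complex.norm_real]
  exact H x hx s hs t ht hts

lemma UU_deriv {α β₀ β₁ T g : ℝ} (hα : α ∈ Ioo (0:ℝ) 1) (hβ₁ : β₁ ≠ 0)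
    (hg : 0 ≤ g) (hgd : g * (1 - α) = β₀ / β₁) (hT : 0 < T)
    {u v : ℝ → ℝ → ℝ} (h : IsDegRobinSol α β₀ β₁ T u v) {s : ℝ} (hs : s ∈ Ioo 0 T) :
    HasDerivAt (fun t => Gop α g hα.2 hg (UU u t)) (-UU u s) s := by
  rw [hasDerivAt_iff_isLittleO, Asymptotics.isLittleO_iff]
  intro ε hε
  obtain ⟨δ, hδ, H⟩ := unif h hε
  have hs' := Ioo_subset_Icc_self hs
  filter_upwards [isOpen_Ioo.mem_nhds hs, Metric.ball_mem_nhds s hδ] with t ht htδ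
  have ht' := Ioo_subset_Icc_self ht
  rw [Metric.mem_ball, Real.dist_eq] at htδ
  have hst : uIcc s t ⊆ Icc 0 T := (ordConnected_Icc).uIcc_subset hs' ht'
  rw [← map_sub]
  refine norm_le_sup (by positivity) ?_
  have hdiff : ∀ᵐ x ∂mu, (UU u t - UU u s : Lp ℂ 2 mu) x = ((u x t - u x s : ℝ) : ℂ) := by
    filter_upwards [UU_coe h hs', UU_coe h ht', Lp.coeFn_sub (UU u t) (UU u s)] with x h1 h2 h3
    rw [h3, Pi.sub_apply, h1, h2, Complex.ofReal_sub]
  filter_upwards [UU_coe h hs', ae_mem, Gop_coe hα.2 hg (UU u t - UU u s),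
    Lp.coeFn_sub (Gop α g hα.2 hg (UU u t - UU u s)) ((t - s) • -UU u s),
    Lp.coeFn_smul (t - s) (-UU u s), Lp.coeFn_neg (UU u s)] with x h1 hx h2 h3 h4 h5
  rw [h3, Pi.sub_apply, h2, h4, Pi.smul_apply, h5, Pi.neg_apply, h1, gf_congr hdiff hx,
    repr_aux hα hβ₁ hg hgd hT h hs ht hx]
  have cux : ContinuousOn (u x) (uIcc s t) :=
    h.cont_u.comp (f := fun r => (x, r)) (by fun_prop) fun r hr => ⟨hx, hst hr⟩
  have e : -((∫ r in s..t, u x r : ℝ) : ℂ) - (t - s) • -((u x s : ℝ) : ℂ) =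
      ((-∫ r in s..t, (u x r - u x s) : ℝ) : ℂ) := by
    rw [intervalIntegral.integral_sub cux.intervalIntegrable intervalIntegrable_const,
      intervalIntegral.integral_const, Complex.real_smul, smul_eq_mul]
    push_cast; ring
  rw [e, Complex.norm_real, norm_neg, Real.norm_eq_abs (t - s)]
  refine intervalIntegral.norm_integral_le_of_norm_le_const fun r hr => ?_
  have hr2 := uIoc_subset_uIcc hr
  refine H x hx s hs' r (hst hr2) (lt_of_le_of_lt ?_ htδ)
  exact abs_sub_left_of_mem_uIcc hr2

end DegRobin

namespace DegRobin

noncomputable def cc (α : ℝ) : ℕ → ℝ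
  | 0 => 1
  | j + 1 => cc α j / (((2 - α) * j + 1) * ((2 - α) * j + 2 - α))

noncomputable def dd (α : ℝ) : ℕ → ℝ
  | 0 => 1
  | j + 1 => dd α j / (((2 - α) * j + 1 - α + 1) * ((2 - α) * j + 1 - α + 2 - α))

noncomputable def MM (α g : ℝ) (j : ℕ) (x : ℝ) : ℝ :=
  cc α j * x ^ ((2 - α) * j) + g * dd α j * x ^ ((2 - α) * j + 1 - α)

section
variable {α g : ℝ}

lemma cc_bound (hα : α < 1) (j : ℕ) : 0 ≤ cc α j ∧ cc α j ≤ 1 / ((j.factorial : ℝ) ^ 2) := by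
  induction j with
  | zero => simp [cc]
  | succ j ih =>
    have hj : (0:ℝ) ≤ j := j.cast_nonneg
    have h1 : (j:ℝ) + 1 ≤ (2 - α) * j + 1 := by nlinarith
    have h2 : (j:ℝ) + 1 ≤ (2 - α) * j + 2 - α := by nlinarith
    have h3 : ((j:ℝ) + 1) ^ 2 ≤ ((2 - α) * j + 1) * ((2 - α) * j + 2 - α) := by
      rw [sq]; exact mul_le_mul h1 h2 (by positivity) (by linarith)
    have h0 : (0:ℝ) < ((j:ℝ) + 1) ^ 2 := by positivity
    simp only [cc]
    refine ⟨div_nonneg ih.1 (by linarith), ?_⟩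
    rw [Nat.factorial_succ]; push_cast
    have : 1 / (((j:ℝ) + 1) * j.factorial) ^ 2 = (1 / ((j.factorial : ℝ) ^ 2)) / (((j:ℝ) + 1) ^ 2) := by
      rw [mul_pow]; field_simp
    rw [this]
    exact div_le_div₀ (by positivity) ih.2 h0 h3

lemma dd_bound (hα : α < 1) (j : ℕ) : 0 ≤ dd α j ∧ dd α j ≤ 1 / ((j.factorial : ℝ) ^ 2) := by
  induction j with
  | zero => simp [dd]
  | succ j ih =>
    have hj : (0:ℝ) ≤ j := j.cast_nonneg
    have h1 : (j:ℝ) + 1 ≤ (2 - α) * j + 1 - α + 1 := by nlinarith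
    have h2 : (j:ℝ) + 1 ≤ (2 - α) * j + 1 - α + 2 - α := by nlinarith
    have h3 : ((j:ℝ) + 1) ^ 2 ≤ ((2 - α) * j + 1 - α + 1) * ((2 - α) * j + 1 - α + 2 - α) := by
      rw [sq]; exact mul_le_mul h1 h2 (by positivity) (by linarith)
    have h0 : (0:ℝ) < ((j:ℝ) + 1) ^ 2 := by positivity
    simp only [dd]
    refine ⟨div_nonneg ih.1 (by linarith), ?_⟩
    rw [Nat.factorial_succ]; push_cast
    have : 1 / (((j:ℝ) + 1) * j.factorial) ^ 2 = (1 / ((j.factorial : ℝ) ^ 2)) / (((j:ℝ) + 1) ^ 2) := by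
      rw [mul_pow]; field_simp
    rw [this]
    exact div_le_div₀ (by positivity) ih.2 h0 h3

lemma MM_cont (hα : α < 1) (j : ℕ) : Continuous (MM α g j) := by
  have hj : (0:ℝ) ≤ j := j.cast_nonneg
  have h1 : Continuous (fun x : ℝ => x ^ ((2 - α) * j)) :=
    Real.continuous_rpow_const (by nlinarith)
  have h2 : Continuous (fun x : ℝ => x ^ ((2 - α) * j + 1 - α)) :=
    Real.continuous_rpow_const (by nlinarith)
  unfold MM
  fun_prop

lemma N_MM (hα : α < 1) (j : ℕ) {x : ℝ} (hx : x ∈ Icc (0:ℝ) 1) :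
    Nop α (fun z => ((MM α g j z : ℝ) : ℂ)) x = ((MM α g (j + 1) x : ℝ) : ℂ) := by
  have hj : (0:ℝ) ≤ j := j.cast_nonneg
  have p1 : 0 ≤ (2 - α) * j := by nlinarith
  have p2 : 0 ≤ (2 - α) * j + 1 - α := by nlinarith
  have h1 : Continuous (fun x : ℝ => ((x ^ ((2 - α) * j) : ℝ) : ℂ)) :=
    Complex.continuous_ofReal.comp (Real.continuous_rpow_const p1)
  have h2 : Continuous (fun x : ℝ => ((x ^ ((2 - α) * j + 1 - α) : ℝ) : ℂ)) :=
    Complex.continuous_ofReal.comp (Real.continuous_rpow_const p2)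
  have e : (fun z => ((MM α g j z : ℝ) : ℂ)) = fun z => 
      ((cc α j : ℝ) : ℂ) * ((z ^ ((2 - α) * j) : ℝ) : ℂ) +
      ((g * dd α j : ℝ) : ℂ) * ((z ^ ((2 - α) * j + 1 - α) : ℝ) : ℂ) := by
    funext z
    simp only [MM]; push_cast; ring
  have i1 : IntervalIntegrable (fun z : ℝ => ((cc α j : ℝ) : ℂ) * ((z ^ ((2 - α) * j) : ℝ) : ℂ))
      volume 0 1 := (continuous_const.mul h1).intervalIntegrable _ _
  have i2 : IntervalIntegrable (fun z : ℝ => ((g * dd α j : ℝ) : ℂ) *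
      ((z ^ ((2 - α) * j + 1 - α) : ℝ) : ℂ)) volume 0 1 :=
    (continuous_const.mul h2).intervalIntegrable _ _
  rw [e, N_add hα i1 i2 hx, N_smul, N_smul, N_pow hα _ p1 hx.1,
    N_pow hα _ p2 hx.1, ← Complex.ofReal_mul, ← Complex.ofReal_mul, ← Complex.ofReal_add]
  congr 1
  have e1 : (2 - α) * ((j + 1 : ℕ) : ℝ) = (2 - α) * j + 2 - α := by push_cast; ring
  have e2 : (2 - α) * ((j + 1 : ℕ) : ℝ) + 1 - α = (2 - α) * j + 1 - α + 2 - α := by push_cast; ring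
  simp only [MM, e1, cc, dd]
  have e3 : (2 - α) * j + 2 - α + 1 - α = (2 - α) * j + 1 - α + 2 - α := by ring
  rw [e3]
  ring

lemma expansion (hα : α < 1) (G : ℕ → ℝ → ℂ) (b : ℕ → ℂ) (K : ℕ → ℝ)
    (hc : ∀ k, ContinuousOn (G k) (Icc 0 1)) (hK : ∀ k, ∀ x ∈ Icc (0:ℝ) 1, ‖G k x‖ ≤ K k)
    (hG : ∀ k, ∀ x ∈ Icc (0:ℝ) 1, 
      G k x = b k * ((1 + g * x ^ (1 - α) : ℝ) : ℂ) - Nop α (G (k + 1)) x) (J : ℕ) :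
    ∀ k, ∀ x ∈ Icc (0:ℝ) 1, 
      ‖G k x + ∑ j ∈ Finset.range J, (-((-1) ^ j * b (k + j))) * ((MM α g j x : ℝ) : ℂ)‖ 
        ≤ K (k + J) * cc α J * x ^ ((2 - α) * J) := by
  induction J with
  | zero => intro k x hx; simpa [cc] using hK k x hx
  | succ J ih =>
    intro k x hx
    have hj : (0:ℝ) ≤ J := J.cast_nonneg
    have ii : ∀ j, IntervalIntegrable (fun z => (-((-1) ^ j * b (k + 1 + j))) * 
        ((MM α g j z : ℝ) : ℂ)) volume 0 1 := fun j =>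
      (continuous_const.mul (Complex.continuous_ofReal.comp (MM_cont hα j))).intervalIntegrable _ _
    have iis : IntervalIntegrable (fun z => ∑ j ∈ Finset.range J, (-((-1) ^ j * b (k + 1 + j))) * 
        ((MM α g j z : ℝ) : ℂ)) volume 0 1 := by
      refine Continuous.intervalIntegrable ?_ _ _
      refine continuous_finsetSum _ fun j _ => ?_
      exact continuous_const.mul (Complex.continuous_ofReal.comp (MM_cont hα j))
    have key : G k x + ∑ j ∈ Finset.range (J + 1), 
        (-((-1) ^ j * b (k + j))) * ((MM α g j x : ℝ) : ℂ) =
        -Nop α (fun z => G (k + 1) z + ∑ j ∈ Finset.range J, (-((-1) ^ j * b (k + 1 + j))) * 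
        ((MM α g j z : ℝ) : ℂ)) x := by
      have iG : IntervalIntegrable (G (k+1)) volume 0 1 := by
        refine ContinuousOn.intervalIntegrable ?_
        rw [uIcc_of_le zero_le_one]; exact hc _
      rw [N_add hα iG iis hx, N_sum hα _ _ ii hx, Finset.sum_range_succ', hG k x hx]
      have : ∀ j ∈ Finset.range J, Nop α (fun z => (-((-1) ^ j * b (k + 1 + j))) * 
        ((MM α g j z : ℝ) : ℂ)) x = -(-((-1) ^ (j+1) * b (k + (j + 1))) * 
          ((MM α g (j+1) x : ℝ) : ℂ)) := by
        intro j _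
        rw [N_smul, N_MM hα j hx, pow_succ, show k + 1 + j = k + (j + 1) by ring]
        ring
      rw [Finset.sum_congr rfl this, Finset.sum_neg_distrib]
      have e0 : MM α g 0 x = 1 + g * x ^ (1 - α) := by simp [MM, cc, dd]
      rw [e0]
      simp only [pow_zero, add_zero]
      ring
    rw [key, norm_neg]
    have := N_le hα ((2 - α) * J) (by nlinarith) _ (K (k + 1 + J) * cc α J) 
      (fun z hz => ih (k + 1) z hz) hx
    refine this.trans (le_of_eq ?_)
    have e1 : (2 - α) * ((J + 1 : ℕ) : ℝ) = (2 - α) * J + 2 - α := by push_cast; ring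
    rw [e1, show k + 1 + J = k + (J + 1) by ring]
    simp only [cc]
    ring

end

lemma main_exp {α β₀ β₁ T g : ℝ} (hα : α ∈ Ioo (0:ℝ) 1) (hβ₁ : β₁ ≠ 0)
    (hg : 0 ≤ g) (hgd : g * (1 - α) = β₀ / β₁) (hT : 0 < T)
    {u v : ℝ → ℝ → ℝ} (h : IsDegRobinSol α β₀ β₁ T u v) :
    ‖UU u T‖ ≤ ‖UU u 0‖ ∧ ∃ β : ℕ → ℝ, 
      (∀ j, |β j| ≤ 2 / (1 - α) * ((j + 1).factorial / T ^ (j + 1) * ‖UU u 0‖)) ∧ 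
      ∀ J, ∀ x ∈ Icc (0:ℝ) 1, |u x T - ∑ j ∈ Finset.range J, β j * MM α g j x| ≤ 
        2 / (1 - α) * ((J + 1).factorial / T ^ (J + 1) * ‖UU u 0‖) * (1 / (J.factorial : ℝ) ^ 2) := by
  obtain ⟨y, y0, yG, yb⟩ := semigroup (Gop α g hα.2 hg) (Gop_nonneg hα.2 hg) (Gop_inj hα.2 hg) T hT
    (UU u) (UU_cont h) (fun t ht => UU_deriv hα hβ₁ hg hgd hT h ht)
  have h1α : 0 < 1 - α := by linarith [hα.2]
  refine ⟨by simpa [y0] using yb 0, ?_⟩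
  set K : ℕ → ℝ := fun k => 2 / (1 - α) * ((k + 1).factorial / T ^ (k + 1) * ‖UU u 0‖) with hKdef
  set G : ℕ → ℝ → ℂ := fun k => gf α g (y (k + 1)) with hGdef
  have hyG : ∀ k, ∀ᵐ x ∂mu, y k x = G k x := by
    intro k
    filter_upwards [Gop_coe hα.2 hg (y (k + 1))] with x hx
    rw [yG] at hx
    exact hx
  have Ib : ∀ k, ∫ z in (0:ℝ)..1, ‖y (k+1) z‖ ≤ (k + 1).factorial / T ^ (k + 1) * ‖UU u 0‖ :=
    fun k => (int_norm_le _).trans (yb _)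
  have hGK : ∀ k, ∀ x ∈ Icc (0:ℝ) 1, ‖G k x‖ ≤ K k := by
    intro k x hx
    refine (gf_bound hα.2 hg (Lp_ii _) hx).trans ?_
    exact mul_le_mul_of_nonneg_left (Ib k) (by positivity)
  set b : ℕ → ℂ := fun k => Nop α (y (k + 1)) 1 / ((1 + g : ℝ) : ℂ) with hb
  have hbK : ∀ k, ‖b k‖ ≤ K k := by
    intro k
    have h1 := (N_bound hα.2 (Lp_ii (y (k+1))) (x := 1) (by simp)).trans 
      (div_le_div_of_nonneg_right (Ib k) h1α.le)
    rw [hb]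
    simp only [norm_div, Complex.norm_real]
    have h2 : ‖1 + g‖ = 1 + g := abs_of_nonneg (by positivity)
    rw [h2]
    have h3 : ‖Nop α (y (k + 1)) 1‖ / (1 + g) ≤ ‖Nop α (y (k + 1)) 1‖ := 
      div_le_self (norm_nonneg _) (by linarith)
    refine h3.trans (h1.trans ?_)
    have h4 : 0 ≤ (k + 1).factorial / T ^ (k + 1) * ‖UU u 0‖ := by positivity
    simp only [hKdef]
    rw [div_mul_eq_mul_div (2:ℝ)]
    exact div_le_div_of_nonneg_right (by linarith) h1α.le
  have hexp := expansion (g := g) hα.2 G b K (fun k => gf_cont hα.2 (Lp_ii _)) hGK (by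
    intro k x hx
    rw [← N_congr (hyG (k+1)) hx]
    simp only [hGdef, gf, hb]
    push_cast; ring)
  have huG : ∀ x ∈ Icc (0:ℝ) 1, ((u x T : ℝ) : ℂ) = G 0 x := by
    have hTm : T ∈ Icc 0 T := ⟨hT.le, le_rfl⟩
    refine Measure.eqOn_Icc_of_ae_eq (μ := volume) zero_ne_one ?_ ?_ (gf_cont hα.2 (Lp_ii _))
    · rw [← restrict_Ioc_eq_restrict_Icc]
      filter_upwards [UU_coe h hTm, hyG 0] with x h1 h2
      rw [← h1, ← h2, y0]
    · exact Complex.continuous_ofReal.comp_continuousOn 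
        (h.cont_u.comp (f := fun x => (x, T)) (by fun_prop) fun x hx => ⟨hx, hTm⟩)
  refine ⟨fun j => ((-1) ^ j * b j).re, fun j => ?_, fun J x hx => ?_⟩
  · refine (Complex.abs_re_le_norm _).trans ?_
    simpa using hbK j
  · have h1 := hexp J 0 x hx
    rw [← huG x hx] at h1
    have e : u x T - ∑ j ∈ Finset.range J, ((-1) ^ j * b j).re * MM α g j x = 
       (((u x T : ℝ) : ℂ) + ∑ j ∈ Finset.range J, (-((-1) ^ j * b (0 + j))) * 
         ((MM α g j x : ℝ) : ℂ)).re := by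
      rw [Complex.add_re, Complex.re_sum, Complex.ofReal_re, sub_eq_add_neg, 
        ← Finset.sum_neg_distrib]
      congr 1
      refine Finset.sum_congr rfl fun j _ => ?_
      rw [Complex.re_mul_ofReal, Complex.neg_re, zero_add]
      ring
    show |u x T - ∑ j ∈ Finset.range J, ((-1) ^ j * b j).re * MM α g j x| ≤ _
    rw [e]
    refine (Complex.abs_re_le_norm _).trans (h1.trans ?_)
    rw [zero_add]
    have hx1 : x ^ ((2 - α) * J) ≤ 1 := Real.rpow_le_one hx.1 hx.2 (by
      have : (0:ℝ) ≤ J := J.cast_nonneg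
      nlinarith [hα.2])
    have hK0 : 0 ≤ K J := by simp only [hKdef]; positivity
    have hcb := cc_bound hα.2 J
    calc K J * cc α J * x ^ ((2 - α) * J) ≤ K J * cc α J * 1 := 
          mul_le_mul_of_nonneg_left hx1 (mul_nonneg hK0 hcb.1)
      _ ≤ _ := by rw [mul_one]; exact mul_le_mul_of_nonneg_left hcb.2 hK0

end DegRobin

namespace DegRobin

lemma exp_tail (y q : ℝ) (hq : 0 < q) (hq1 : q ≤ 1) (n : ℕ) :
    |Real.exp y - ∑ m ∈ Finset.range n, y ^ m / m.factorial| ≤ q ^ n * Real.exp (|y| / q) := by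
  have h1 : |Real.exp y - ∑ m ∈ Finset.range n, y ^ m / m.factorial| ≤
      Real.exp |y| - ∑ m ∈ Finset.range n, |y| ^ m / m.factorial := by
    have := Complex.norm_exp_sub_sum_le_exp_norm_sub_sum (y : ℂ) n
    rw [Complex.norm_real, Real.norm_eq_abs] at this
    refine le_trans (le_of_eq ?_) this
    rw [← Real.norm_eq_abs, ← Complex.norm_real]
    push_cast
    rfl
  refine h1.trans ?_
  set t := |y| with ht
  have ht0 : 0 ≤ t := abs_nonneg y
  have hs : HasSum (fun m : ℕ => t ^ m / m.factorial) (Real.exp t) := by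
    rw [Real.exp_eq_exp_ℝ]; exact NormedSpace.expSeries_div_hasSum_exp t
  have htd := hs.tendsto_sum_nat
  rw [sub_le_iff_le_add]
  refine le_of_tendsto htd ?_
  filter_upwards [Filter.eventually_ge_atTop n] with N hN
  rw [← Finset.sum_range_add_sum_Ico _ hN, add_comm]
  refine add_le_add_left ?_ _
  have h2 : ∑ m ∈ Finset.Ico n N, t ^ m / m.factorial ≤
      ∑ m ∈ Finset.Ico n N, q ^ n * ((t / q) ^ m / m.factorial) := by
    refine Finset.sum_le_sum fun m hm => ?_
    have hnm := (Finset.mem_Ico.1 hm).1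
    rw [← mul_div_assoc]
    refine div_le_div_of_nonneg_right ?_ (by positivity)
    have hqm : q ^ m ≤ q ^ n := pow_le_pow_of_le_one hq.le hq1 hnm
    calc t ^ m = q ^ m * (t / q) ^ m := by rw [← mul_pow]; congr 1; field_simp
      _ ≤ _ := mul_le_mul_of_nonneg_right hqm (by positivity)
  refine h2.trans ?_
  rw [← Finset.mul_sum]
  refine mul_le_mul_of_nonneg_left ?_ (by positivity)
  refine le_trans ?_ (Real.sum_le_exp_of_nonneg (x := t / q) (by positivity) N)
  refine Finset.sum_le_sum_of_subset_of_nonneg (fun m hm => ?_) fun m _ _ => by positivity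
  exact Finset.mem_range.2 (Finset.mem_Ico.1 hm).2

open Polynomial in
noncomputable def expPoly (p : ℝ) (n : ℕ) : ℝ[X] :=
  ∑ m ∈ Finset.range n, C (p ^ m / m.factorial) * X ^ m

lemma expPoly_eval (p w : ℝ) (n : ℕ) :
    (expPoly p n).eval w = ∑ m ∈ Finset.range n, (p * w) ^ m / m.factorial := by
  unfold expPoly
  rw [Polynomial.eval_finsetSum]
  refine Finset.sum_congr rfl fun m _ => ?_
  simp [mul_pow]; ring

lemma expPoly_mem (p : ℝ) (n : ℕ) : expPoly p n ∈ Polynomial.degreeLT ℝ n := by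
  unfold expPoly
  refine Submodule.sum_mem _ fun m hm => ?_
  rw [Polynomial.mem_degreeLT]
  refine lt_of_le_of_lt (Polynomial.degree_C_mul_X_pow_le _ _) ?_
  exact_mod_cast Finset.mem_range.1 hm

lemma expPoly_err {p P L w q : ℝ} (hp : 0 ≤ p) (hpP : p ≤ P) (hw : w ∈ Icc (-L) 0)
    (hq : 0 < q) (hq1 : q ≤ 1) (n : ℕ) :
    |Real.exp w ^ p - (expPoly p n).eval w| ≤ q ^ n * Real.exp (L / q * P) := by
  rw [expPoly_eval, ← Real.exp_mul, mul_comm w p]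
  refine (exp_tail _ q hq hq1 n).trans ?_
  refine mul_le_mul_of_nonneg_left (Real.exp_le_exp.2 ?_) (by positivity)
  have hw' : |w| ≤ L := by rw [abs_le]; exact ⟨hw.1, by linarith [hw.1, hw.2]⟩
  have hL : 0 ≤ L := (abs_nonneg w).trans hw'
  rw [abs_mul, abs_of_nonneg hp, div_mul_eq_mul_div]
  refine div_le_div_of_nonneg_right ?_ hq.le
  rw [mul_comm]
  exact mul_le_mul hw' hpP hp hL

noncomputable def MPoly (α g : ℝ) (j n : ℕ) : Polynomial ℝ :=
  cc α j • expPoly ((2 - α) * j) n + (g * dd α j) • expPoly ((2 - α) * j + 1 - α) n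

lemma MPoly_mem (α g : ℝ) (j n : ℕ) : MPoly α g j n ∈ Polynomial.degreeLT ℝ n :=
  Submodule.add_mem _ (Submodule.smul_mem _ _ (expPoly_mem _ _))
    (Submodule.smul_mem _ _ (expPoly_mem _ _))

lemma MPoly_err {α g L w q : ℝ} (hα : α ∈ Ioo (0:ℝ) 1) (hg : 0 ≤ g) (hw : w ∈ Icc (-L) 0)
    (hq : 0 < q) (hq1 : q ≤ 1) (j n : ℕ) :
    |MM α g j (Real.exp w) - (MPoly α g j n).eval w| ≤
      (1 + g) * (1 / (j.factorial : ℝ) ^ 2) * (q ^ n * Real.exp (L / q) ^ (2 * j + 1)) := by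
  have hj : (0:ℝ) ≤ j := j.cast_nonneg
  have hα1 := hα.1
  have hα2 := hα.2
  have h1 := expPoly_err (p := (2 - α) * j) (P := 2 * j + 1) (by nlinarith) (by nlinarith) hw hq hq1 n
  have h2 := expPoly_err (p := (2 - α) * j + 1 - α) (P := 2 * j + 1) (by nlinarith) (by nlinarith)
    hw hq hq1 n
  have e : Real.exp (L / q * (2 * j + 1)) = Real.exp (L / q) ^ (2 * j + 1) := by
    rw [← Real.exp_nat_mul]; push_cast; congr 1; ring
  rw [e] at h1 h2
  set Q := q ^ n * Real.exp (L / q) ^ (2 * j + 1) with hQ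
  have hQ0 : 0 ≤ Q := by positivity
  have hc := cc_bound hα2 j
  have hd := dd_bound hα2 j
  set F := 1 / (j.factorial : ℝ) ^ 2 with hF
  have e2 : MM α g j (Real.exp w) - (MPoly α g j n).eval w =
      cc α j * (Real.exp w ^ ((2 - α) * j) - (expPoly ((2 - α) * j) n).eval w) +
      g * dd α j * (Real.exp w ^ ((2 - α) * j + 1 - α) -
        (expPoly ((2 - α) * j + 1 - α) n).eval w) := by
    simp only [MM, MPoly, Polynomial.eval_add, Polynomial.eval_smul, smul_eq_mul]
    ring
  rw [e2]
  refine (abs_add_le _ _).trans ?_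
  rw [abs_mul, abs_mul (g * dd α j), abs_of_nonneg hc.1, abs_of_nonneg (mul_nonneg hg hd.1)]
  have h3 : cc α j * |Real.exp w ^ ((2 - α) * j) - (expPoly ((2 - α) * j) n).eval w| ≤ F * Q :=
    mul_le_mul hc.2 h1 (abs_nonneg _) (by positivity)
  have h4 : g * dd α j * |Real.exp w ^ ((2 - α) * j + 1 - α) -
        (expPoly ((2 - α) * j + 1 - α) n).eval w| ≤ g * F * Q :=
    mul_le_mul (mul_le_mul_of_nonneg_left hd.2 hg) h2 (abs_nonneg _) (by positivity)
  linarith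

lemma poly_approx {α g T a q U K : ℝ} (hα : α ∈ Ioo (0:ℝ) 1) (hg : 0 ≤ g) (hT : 0 < T)
    (ha : a ∈ Ioo (0:ℝ) 1) (hq : 0 < q) (hq1 : q ≤ 1) (hU : 0 ≤ U) (hK : 0 ≤ K)
    (f : ℝ → ℝ) (β : ℕ → ℝ)
    (hβ : ∀ j, |β j| ≤ K * ((j + 1).factorial / T ^ (j + 1) * U))
    (hf : ∀ J, ∀ x ∈ Icc (0:ℝ) 1, |f x - ∑ j ∈ Finset.range J, β j * MM α g j x| ≤
        K * ((J + 1).factorial / T ^ (J + 1) * U) * (1 / (J.factorial : ℝ) ^ 2)) (n : ℕ) :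
    ∃ p : Polynomial ℝ, p.degree < n ∧ ∀ x ∈ Icc a 1, |f x - p.eval (Real.log x)| ≤
      K * (1 + g) * (Real.exp (-Real.log a / q) + 1) *
        Real.exp ((1 + 2 * Real.exp (-Real.log a / q) ^ 2) / T) * q ^ n * U := by
  set L := -Real.log a with hL
  set E := Real.exp (L / q) with hE
  have hE0 : 0 < E := Real.exp_pos _
  have hfac : ∀ j : ℕ, ((j + 1).factorial : ℝ) / T ^ (j + 1) * (1 / (j.factorial : ℝ) ^ 2) ≤
      1 / T * ((2 / T) ^ j / j.factorial) := by
    intro j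
    have h1 : ((j:ℝ) + 1) ≤ 2 ^ j := by
      have := Nat.lt_two_pow_self (n := j)
      exact_mod_cast this
    have : ((j + 1).factorial : ℝ) / T ^ (j + 1) * (1 / (j.factorial : ℝ) ^ 2) =
        1 / T * ((j + 1) * (1 / T) ^ j / j.factorial) := by
      rw [Nat.factorial_succ, pow_succ, div_pow 1, one_pow]; push_cast
      field_simp
    rw [this, div_pow, div_pow, one_pow]
    refine mul_le_mul_of_nonneg_left ?_ (by positivity)
    refine div_le_div_of_nonneg_right ?_ (by positivity)
    rw [mul_one_div]
    exact div_le_div_of_nonneg_right h1 (by positivity)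
  obtain ⟨J, hJ⟩ : ∃ J : ℕ, 1 / T * ((2 / T) ^ J / J.factorial) ≤ q ^ n := by
    have := (FloorSemiring.tendsto_pow_div_factorial_atTop (2 / T)).const_mul (1 / T)
    rw [mul_zero] at this
    exact ((this.eventually (ge_mem_nhds (show (0:ℝ) < q ^ n by positivity)))).exists
  refine ⟨∑ j ∈ Finset.range J, β j • MPoly α g j n, ?_, fun x hx => ?_⟩
  · rw [← Polynomial.mem_degreeLT]
    exact Submodule.sum_mem _ fun j _ => Submodule.smul_mem _ _ (MPoly_mem _ _ _ _)
  have hx0 : 0 < x := ha.1.trans_le hx.1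
  have hw : Real.log x ∈ Icc (-L) 0 := by
    rw [hL, neg_neg]
    exact ⟨Real.log_le_log ha.1 hx.1, Real.log_nonpos hx0.le hx.2⟩
  have h1 := hf J x ⟨hx0.le, hx.2⟩
  have h2 : |∑ j ∈ Finset.range J, β j * MM α g j x -
      (∑ j ∈ Finset.range J, β j • MPoly α g j n).eval (Real.log x)| ≤
      K * (1 + g) * q ^ n * U * E * (1 / T) * Real.exp (2 * E ^ 2 / T) := by
    rw [Polynomial.eval_finsetSum, ← Finset.sum_sub_distrib]
    refine (Finset.abs_sum_le_sum_abs _ _).trans ?_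
    have : ∀ j ∈ Finset.range J, |β j * MM α g j x - (β j • MPoly α g j n).eval (Real.log x)| ≤
        K * (1 + g) * q ^ n * U * E * (1 / T) * ((2 * E ^ 2 / T) ^ j / j.factorial) := by
      intro j _
      rw [Polynomial.eval_smul, smul_eq_mul, ← mul_sub, abs_mul]
      have h3 := MPoly_err hα hg hw hq hq1 j n
      rw [Real.exp_log hx0, ← hE] at h3
      refine (mul_le_mul (hβ j) h3 (abs_nonneg _) (by positivity)).trans ?_
      have h4 := mul_le_mul_of_nonneg_left (hfac j)
        (show 0 ≤ K * (1 + g) * q ^ n * U * E ^ (2 * j + 1) by positivity)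
      calc _ = K * (1 + g) * q ^ n * U * E ^ (2 * j + 1) *
          (((j + 1).factorial : ℝ) / T ^ (j + 1) * (1 / (j.factorial : ℝ) ^ 2)) := by ring
        _ ≤ _ := h4
        _ = _ := by
          rw [pow_succ, pow_mul, div_pow, div_pow, mul_pow]; ring
    refine (Finset.sum_le_sum this).trans ?_
    rw [← Finset.mul_sum]
    refine mul_le_mul_of_nonneg_left ?_ (by positivity)
    exact Real.sum_le_exp_of_nonneg (by positivity) J
  have h5 : 1 / T ≤ Real.exp (1 / T) := by
    have := Real.add_one_le_exp (1 / T); linarith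
  have h6 : (1 / T) * Real.exp (2 * E ^ 2 / T) ≤ Real.exp ((1 + 2 * E ^ 2) / T) := by
    rw [add_div, Real.exp_add]
    exact mul_le_mul_of_nonneg_right h5 (Real.exp_pos _).le
  have h7 : 1 ≤ Real.exp ((1 + 2 * E ^ 2) / T) := Real.one_le_exp (by positivity)
  set Z := Real.exp ((1 + 2 * E ^ 2) / T) with hZ
  have h8 : |f x - ∑ j ∈ Finset.range J, β j * MM α g j x| ≤ K * (1 + g) * 1 * Z * q ^ n * U := by
    refine h1.trans ?_
    have h9 : (((J + 1).factorial : ℝ) / T ^ (J + 1) * (1 / (J.factorial : ℝ) ^ 2)) ≤ q ^ n :=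
      (hfac J).trans hJ
    calc _ = K * U * (((J + 1).factorial : ℝ) / T ^ (J + 1) * (1 / (J.factorial : ℝ) ^ 2)) := by ring
      _ ≤ K * U * q ^ n := mul_le_mul_of_nonneg_left h9 (by positivity)
      _ = K * 1 * 1 * 1 * q ^ n * U := by ring
      _ ≤ _ := by gcongr; linarith
  have h10 : K * (1 + g) * q ^ n * U * E * (1 / T) * Real.exp (2 * E ^ 2 / T) ≤
      K * (1 + g) * E * Z * q ^ n * U := by
    calc _ = K * (1 + g) * q ^ n * U * E * ((1 / T) * Real.exp (2 * E ^ 2 / T)) := by ring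
      _ ≤ K * (1 + g) * q ^ n * U * E * Z := mul_le_mul_of_nonneg_left h6 (by positivity)
      _ = _ := by ring
  have := abs_sub_le (f x) (∑ j ∈ Finset.range J, β j * MM α g j x)
    ((∑ j ∈ Finset.range J, β j • MPoly α g j n).eval (Real.log x))
  refine this.trans ((add_le_add h8 (h2.trans h10)).trans (le_of_eq ?_))
  ring

end DegRobin

namespace DegRobin

lemma prod_dist (i m : ℕ) : ∏ j ∈ (Finset.range (i + 1 + m)).erase i, |(i:ℝ) - j| =
    i.factorial * m.factorial := by
  induction m with
  | zero =>
    have e : (Finset.range (i + 1 + 0)).erase i = Finset.range i := by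
      rw [add_zero, Finset.range_add_one, Finset.erase_insert (by simp)]
    rw [e, ← Finset.prod_range_reflect, ← Finset.prod_range_add_one_eq_factorial]
    push_cast
    rw [Nat.factorial_zero, Nat.cast_one, mul_one]
    refine Finset.prod_congr rfl fun j hj => ?_
    have hj' : j < i := Finset.mem_range.1 hj
    have : ((i - 1 - j : ℕ) : ℝ) = (i:ℝ) - 1 - j := by
      rw [Nat.cast_sub (by omega), Nat.cast_sub (by omega)]; simp
    rw [this, show (i:ℝ) - (i - 1 - j) = j + 1 by ring, abs_of_nonneg (by positivity)]
  | succ m ih =>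
    have e : (Finset.range (i + 1 + (m + 1))).erase i =
        insert (i + 1 + m) ((Finset.range (i + 1 + m)).erase i) := by
      rw [← add_assoc, Finset.range_add_one, Finset.erase_insert_of_ne (by omega)]
    rw [e, Finset.prod_insert (by simp), ih, Nat.factorial_succ]
    push_cast
    rw [show (i:ℝ) - (i + 1 + m) = -(m + 1) by ring, abs_neg, abs_of_nonneg (by positivity)]
    ring

lemma remez {L h δ : ℝ} (hh : 0 < h) (hδ : 0 ≤ δ) (n : ℕ) (w : ℕ → ℝ)
    (hsep : ∀ i ∈ Finset.range (n + 1), ∀ j ∈ Finset.range (n + 1),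
      h * |(i:ℝ) - (j:ℝ)| ≤ |w i - w j|) (p : Polynomial ℝ) (hp : p.degree < (n + 1 : ℕ))
    (hpw : ∀ i ∈ Finset.range (n + 1), |p.eval (w i)| ≤ δ) {y : ℝ}
    (hy : ∀ i ∈ Finset.range (n + 1), |y - w i| ≤ L) :
    |p.eval y| ≤ δ * ((2 * (L / h)) ^ n / n.factorial) := by
  have hinj : Set.InjOn w (Finset.range (n + 1)) := by
    intro i hi j hj hij
    have := hsep i (by simpa using hi) j (by simpa using hj)
    rw [hij, sub_self, abs_zero] at this
    have h2 : |(i:ℝ) - j| ≤ 0 := by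
      by_contra hc
      push Not at hc
      nlinarith
    have h3 := abs_nonpos_iff.1 h2
    exact_mod_cast sub_eq_zero.1 h3
  have hpi := Lagrange.eq_interpolate (s := Finset.range (n + 1)) (v := w) (f := p) hinj
    (by simpa using hp)
  have e : p.eval y = ∑ i ∈ Finset.range (n + 1), p.eval (w i) *
      ∏ j ∈ (Finset.range (n + 1)).erase i, ((w i - w j)⁻¹ * (y - w j)) := by
    conv_lhs => rw [hpi]
    rw [Lagrange.interpolate_apply, Polynomial.eval_finsetSum]
    refine Finset.sum_congr rfl fun i _ => ?_
    rw [Polynomial.eval_mul, Polynomial.eval_C, Lagrange.basis, Polynomial.eval_prod]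
    simp [Lagrange.basisDivisor]
  rw [e]
  refine (Finset.abs_sum_le_sum_abs _ _).trans ?_
  have hterm : ∀ i ∈ Finset.range (n + 1), |p.eval (w i) *
      ∏ j ∈ (Finset.range (n + 1)).erase i, ((w i - w j)⁻¹ * (y - w j))| ≤
      δ * ((L / h) ^ n / n.factorial) * (n.choose i : ℝ) := by
    intro i hi
    have hin : i ≤ n := by have := Finset.mem_range.1 hi; omega
    rw [abs_mul, Finset.abs_prod]
    have h1 : ∏ j ∈ (Finset.range (n + 1)).erase i, |(w i - w j)⁻¹ * (y - w j)| ≤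
        ∏ j ∈ (Finset.range (n + 1)).erase i, (L / h) * |(i:ℝ) - j|⁻¹ := by
      refine Finset.prod_le_prod (fun _ _ => abs_nonneg _) fun j hj => ?_
      rw [Finset.mem_erase] at hj
      have hne : 0 < |(i:ℝ) - j| := by
        rw [abs_pos, sub_ne_zero]; exact_mod_cast hj.1.symm
      rw [abs_mul, abs_inv]
      have h2 : |w i - w j|⁻¹ ≤ (h * |(i:ℝ) - j|)⁻¹ :=
        inv_anti₀ (by positivity) (hsep i hi j hj.2)
      refine (mul_le_mul h2 (hy j hj.2) (abs_nonneg _) (by positivity)).trans (le_of_eq ?_)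
      rw [mul_inv]; ring
    have h3 : ∏ j ∈ (Finset.range (n + 1)).erase i, (L / h) * |(i:ℝ) - j|⁻¹ =
        (L / h) ^ n / n.factorial * (n.choose i : ℝ) := by
      rw [Finset.prod_mul_distrib, Finset.prod_const, Finset.card_erase_of_mem hi,
        Finset.card_range, Finset.prod_inv_distrib]
      have := prod_dist i (n - i)
      rw [show i + 1 + (n - i) = n + 1 by omega] at this
      rw [this, Nat.cast_choose ℝ hin, Nat.add_sub_cancel]
      field_simp
    rw [h3] at h1
    rw [mul_assoc]
    exact mul_le_mul (hpw i hi) h1 (Finset.prod_nonneg fun _ _ => abs_nonneg _) hδ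
  refine (Finset.sum_le_sum hterm).trans (le_of_eq ?_)
  rw [← Finset.mul_sum, ← Nat.cast_sum, Nat.sum_range_choose, mul_pow]
  push_cast
  ring

lemma node {f : ℝ → ℝ} {κ S l r : ℝ} (hf : ContinuousOn f (Icc 0 1)) (hκ : κ ∈ Ioo (0:ℝ) 1)
    (hS : S = ∫ x in Ioo (0:ℝ) κ, f x ^ 2) (hl : 0 < l) (hlr : l < r) (hr : r < κ) :
    ∃ x ∈ Icc l r, f x ^ 2 ≤ S / (r - l) := by
  have hc : ContinuousOn (fun x => f x ^ 2) (Icc 0 1) := hf.pow 2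
  have hi : IntegrableOn (fun x => f x ^ 2) (Icc 0 1) := hc.integrableOn_compact isCompact_Icc
  have hsub1 : Icc l r ⊆ Ioo 0 κ := fun x hx => ⟨hl.trans_le hx.1, hx.2.trans_lt hr⟩
  have hsub2 : Ioo 0 κ ⊆ Icc 0 1 := fun x hx => ⟨hx.1.le, (hx.2.trans hκ.2).le⟩
  obtain ⟨x, hx, hfx⟩ := exists_le_setAverage (μ := volume) (s := Icc l r) (f := fun x => f x ^ 2)
    (by simp [hlr]) (by simp) (hi.mono_set (hsub1.trans hsub2))
  refine ⟨x, hx, hfx.trans ?_⟩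
  rw [setAverage_eq, smul_eq_mul]
  have : volume.real (Icc l r) = r - l := by
    rw [Real.volume_real_Icc_of_le hlr.le]
  rw [this, inv_mul_eq_div]
  refine div_le_div_of_nonneg_right ?_ (by linarith)
  rw [hS]
  exact setIntegral_mono_set (hi.mono_set hsub2)
    (Filter.Eventually.of_forall fun _ => sq_nonneg _) hsub1.eventuallyLE

lemma log_sep {x y : ℝ} (hx : 0 < x) (hy : 0 < y) (hx1 : x ≤ 1) (hy1 : y ≤ 1) :
    |x - y| ≤ |Real.log x - Real.log y| := by
  wlog hxy : y ≤ x generalizing x y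
  · rw [abs_sub_comm, abs_sub_comm (Real.log x)]
    exact this hy hx hy1 hx1 (le_of_not_ge hxy)
  rw [abs_of_nonneg (by linarith), abs_of_nonneg (by linarith [Real.log_le_log hy hxy])]
  have h1 := Real.log_le_sub_one_of_pos (div_pos hy hx)
  rw [Real.log_div hy.ne' hx.ne'] at h1
  have h2 : y / x - 1 = -((x - y) / x) := by field_simp; ring
  have h3 : x - y ≤ (x - y) / x := by
    rw [le_div_iff₀ hx]; nlinarith
  linarith

/-- three-spheres type bound: the function on `[κ,1]` from its `L²` mass on `(0,κ)`. -/
lemma prop_small {κ : ℝ} (hκ : κ ∈ Ioo (0:ℝ) 1) :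
    ∃ B : ℝ, 1 < B ∧ ∃ K1 : ℝ, 1 ≤ K1 ∧ ∀ f : ℝ → ℝ, ContinuousOn f (Icc 0 1) →
      ∀ n : ℕ, ∀ D ≥ (0:ℝ), (∃ p : Polynomial ℝ, p.degree < (n + 1 : ℕ) ∧
        ∀ x ∈ Icc (κ / 2) 1, |f x - p.eval (Real.log x)| ≤ D * (1 / B ^ 2) ^ (n + 1)) →
      ∀ x ∈ Icc κ 1, |f x| ≤ K1 * (B ^ (n + 1) * √(∫ x in Ioo (0:ℝ) κ, f x ^ 2) +
        D * (1 / B) ^ (n + 1)) := by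
  set L := -Real.log (κ / 2) with hL
  have hκ0 := hκ.1
  have hκ1 := hκ.2
  have hL0 : 0 < L := by
    rw [hL, neg_pos]; exact Real.log_neg (by linarith) (by linarith)
  set η := κ / 4 with hη
  have hη0 : 0 < η := by positivity
  set Λ := Real.exp 1 * (2 * L / η + 1) with hΛ
  have hΛ1 : 1 ≤ Λ := by
    have h1 : 1 ≤ Real.exp 1 := Real.one_le_exp zero_le_one
    have h2 : 1 ≤ 2 * L / η + 1 := by
      have : 0 ≤ 2 * L / η := by positivity
      linarith
    exact one_le_mul_of_one_le_of_one_le h1 h2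
  have hB : 1 < 2 * Λ := by linarith
  refine ⟨2 * Λ, hB, 2 + 1 / η, by have : 0 < 1 / η := by positivity
                                   linarith, ?_⟩
  intro f hf n D hD hpoly x hx
  obtain ⟨p, hpd, hp⟩ := hpoly
  set B := 2 * Λ with hBdef
  set S := ∫ x in Ioo (0:ℝ) κ, f x ^ 2 with hS
  have hS0 : 0 ≤ S := integral_nonneg fun _ => sq_nonneg _
  set N : ℝ := (n:ℝ) + 1 with hN
  have hN0 : 0 < N := by positivity
  set h := η / N with hh
  have hh0 : 0 < h := by positivity
  have hNh : N * h = κ / 4 := by rw [hh, hη]; field_simp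
  have hnodes : ∀ i : ℕ, ∃ y : ℝ, i < n + 1 → (y ∈ Icc (κ / 2 + 2 * i * h) (κ / 2 + (2 * i + 1) * h) ∧
      f y ^ 2 ≤ S / h) := by
    intro i
    by_cases hi : i < n + 1
    · have hi' : (i:ℝ) + 1 ≤ N := by rw [hN]; exact_mod_cast hi
      have hi0 : (0:ℝ) ≤ i := i.cast_nonneg
      obtain ⟨y, hy, hfy⟩ := node (l := κ / 2 + 2 * i * h) (r := κ / 2 + (2 * i + 1) * h) hf hκ hS
        (by positivity) (by nlinarith) (by nlinarith)
      refine ⟨y, fun _ => ⟨hy, ?_⟩⟩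
      rwa [show κ / 2 + (2 * i + 1) * h - (κ / 2 + 2 * i * h) = h by ring] at hfy
    · exact ⟨0, fun h => absurd h hi⟩
  choose y hy using hnodes
  have hyI : ∀ i ∈ Finset.range (n + 1), y i ∈ Icc (κ / 2) 1 := by
    intro i hi
    have hi1 := Finset.mem_range.1 hi
    have hi' : (i:ℝ) + 1 ≤ N := by rw [hN]; exact_mod_cast hi1
    have hi0 : (0:ℝ) ≤ i := i.cast_nonneg
    have := (hy i hi1).1
    have h0 : 0 ≤ 2 * i * h := by positivity
    exact ⟨by linarith [this.1], by nlinarith [this.2]⟩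
  have hsepy : ∀ i j : ℕ, i < j → j < n + 1 → h * |(i:ℝ) - (j:ℝ)| ≤ |y i - y j| := by
    intro i j hij hj
    have h1 := (hy i (hij.trans hj)).1.2
    have h2 := (hy j hj).1.1
    have h3 : (i:ℝ) + 1 ≤ j := by exact_mod_cast hij
    rw [abs_sub_comm, abs_of_nonneg (by linarith), abs_sub_comm]
    refine le_trans ?_ (le_abs_self _)
    nlinarith
  have hsep : ∀ i ∈ Finset.range (n + 1), ∀ j ∈ Finset.range (n + 1),
      h * |(i:ℝ) - (j:ℝ)| ≤ |Real.log (y i) - Real.log (y j)| := by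
    intro i hi j hj
    have h1 := hyI i hi
    have h2 := hyI j hj
    refine le_trans ?_ (log_sep (by linarith [h1.1]) (by linarith [h2.1]) h1.2 h2.2)
    rcases lt_trichotomy i j with hij | hij | hij
    · exact hsepy i j hij (Finset.mem_range.1 hj)
    · rw [hij]; simp
    · rw [abs_sub_comm, abs_sub_comm (y i)]
      exact hsepy j i hij (Finset.mem_range.1 hi)
  have hlog : ∀ z ∈ Icc (κ / 2) 1, Real.log z ∈ Icc (-L) 0 := by
    intro z hz
    rw [hL, neg_neg]
    exact ⟨Real.log_le_log (by linarith) hz.1, Real.log_nonpos (by linarith [hz.1]) hz.2⟩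
  have hxI : x ∈ Icc (κ / 2) 1 := ⟨by linarith [hx.1], hx.2⟩
  have hr : √(1 / h) ≤ (1 + 1 / η) * 2 ^ (n + 1) := by
    have h1 : √(1 / h) ≤ 1 + 1 / h := by
      rw [Real.sqrt_le_left (by positivity)]
      have : 0 < 1 / h := by positivity
      nlinarith
    have h2 : N ≤ 2 ^ (n + 1) := by
      have := (Nat.lt_two_pow_self (n := n + 1)).le
      rw [hN]; exact_mod_cast this
    have h3 : (1:ℝ) ≤ 2 ^ (n + 1) := one_le_pow₀ one_le_two
    have h4 : 1 / h = 1 / η * N := by rw [hh]; field_simp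
    have h5 : 0 < 1 / η := by positivity
    refine h1.trans ?_
    rw [h4]
    nlinarith
  set δ := √S * ((1 + 1 / η) * 2 ^ (n + 1)) + D * (1 / B ^ 2) ^ (n + 1) with hδ
  have hB0 : 0 < B := by linarith
  have hδ0 : 0 ≤ δ := by positivity
  have hfin := remez (L := L) hh0 hδ0 n (fun i => Real.log (y i)) hsep p hpd (by
    intro i hi
    have h1 := hp (y i) (hyI i hi)
    have h2 : |f (y i)| ≤ √S * ((1 + 1 / η) * 2 ^ (n + 1)) := by
      have h3 := Real.sqrt_le_sqrt (hy i (Finset.mem_range.1 hi)).2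
      rw [Real.sqrt_sq_eq_abs, div_eq_mul_one_div, Real.sqrt_mul hS0] at h3
      exact h3.trans (mul_le_mul_of_nonneg_left hr (Real.sqrt_nonneg _))
    have h4 : p.eval (Real.log (y i)) = f (y i) - (f (y i) - p.eval (Real.log (y i))) := by ring
    show |p.eval (Real.log (y i))| ≤ δ
    rw [h4]
    exact (abs_sub _ _).trans (add_le_add h2 h1)) (y := Real.log x) (by
    intro i hi
    have h1 := hlog x hxI
    have h2 := hlog (y i) (hyI i hi)
    rw [abs_le]
    exact ⟨by linarith [h1.1, h2.2], by linarith [h1.2, h2.1]⟩)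
  have hLam : (2 * (L / h)) ^ n / n.factorial ≤ Λ ^ (n + 1) := by
    have e1 : 2 * (L / h) = (2 * L / η) * N := by rw [hh]; field_simp
    have h1 : N ^ n / n.factorial ≤ Real.exp 1 ^ (n + 1) := by
      have := Real.pow_div_factorial_le_exp N hN0.le n
      rwa [← Real.exp_nat_mul, mul_one, Nat.cast_add, Nat.cast_one]
    have h0 : 0 < 2 * L / η := by positivity
    have h2 : (2 * L / η) ^ n ≤ (2 * L / η + 1) ^ (n + 1) :=
      (pow_le_pow_left₀ h0.le (by linarith) n).trans
        (pow_le_pow_right₀ (by linarith) (Nat.le_succ n))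
    rw [e1, mul_pow, mul_div_assoc, hΛ, mul_pow, mul_comm (Real.exp 1 ^ (n + 1))]
    exact mul_le_mul h2 h1 (by positivity) (by positivity)
  have hpx : |p.eval (Real.log x)| ≤ δ * Λ ^ (n + 1) :=
    hfin.trans (mul_le_mul_of_nonneg_left hLam hδ0)
  have hfx : |f x| ≤ δ * Λ ^ (n + 1) + D * (1 / B ^ 2) ^ (n + 1) := by
    have h4 : f x = p.eval (Real.log x) + (f x - p.eval (Real.log x)) := by ring
    rw [h4]
    exact (abs_add_le _ _).trans (add_le_add hpx (hp x hxI))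
  have hq1 : (1 / B ^ 2) ^ (n + 1) * Λ ^ (n + 1) ≤ (1 / B) ^ (n + 1) := by
    rw [← mul_pow]
    refine pow_le_pow_left₀ (by positivity) ?_ _
    rw [one_div_mul_eq_div, div_le_div_iff₀ (by positivity) hB0]
    nlinarith
  have hq2 : (1 / B ^ 2) ^ (n + 1) ≤ (1 / B) ^ (n + 1) := by
    refine le_trans ?_ hq1
    exact le_mul_of_one_le_right (by positivity) (one_le_pow₀ hΛ1)
  have hBp : (2:ℝ) ^ (n + 1) * Λ ^ (n + 1) = B ^ (n + 1) := by rw [← mul_pow]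
  have h5 : 0 < 1 / η := by positivity
  calc |f x| ≤ _ := hfx
    _ = (1 + 1 / η) * (√S * ((2:ℝ) ^ (n + 1) * Λ ^ (n + 1))) +
        D * ((1 / B ^ 2) ^ (n + 1) * Λ ^ (n + 1)) + D * (1 / B ^ 2) ^ (n + 1) := by rw [hδ]; ring
    _ ≤ (1 + 1 / η) * (√S * B ^ (n + 1)) + D * (1 / B) ^ (n + 1) + D * (1 / B) ^ (n + 1) := by
      rw [hBp]; gcongr
    _ ≤ _ := by
      have h6 : 0 ≤ √S * B ^ (n + 1) := by positivity
      have h7 : 0 ≤ D * (1 / B) ^ (n + 1) := by positivity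
      nlinarith

end DegRobin

namespace DegRobin

lemma UU_norm {α β₀ β₁ T : ℝ} {u v : ℝ → ℝ → ℝ} (h : IsDegRobinSol α β₀ β₁ T u v) {t : ℝ}
    (ht : t ∈ Icc 0 T) : ‖UU u t‖ = √(∫ x in Ioo (0:ℝ) 1, u x t ^ 2) := by
  have h1 : ((‖UU u t‖ ^ 2 : ℝ) : ℂ) = ((∫ x in Ioo (0:ℝ) 1, u x t ^ 2 : ℝ) : ℂ) := by
    have h2 := inner_self_eq_norm_sq_to_K (𝕜 := ℂ) (UU u t)
    rw [L2.inner_def] at h2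
    have h3 : ∫ a, inner ℂ ((UU u t) a) ((UU u t) a) ∂mu = ∫ a, ((u a t ^ 2 : ℝ) : ℂ) ∂mu := by
      refine integral_congr_ae ?_
      filter_upwards [UU_coe h ht] with x hx
      rw [hx]
      have e : ((|u x t| : ℝ) : ℂ) * ((|u x t| : ℝ) : ℂ) = ((u x t : ℝ) : ℂ) * ((u x t : ℝ) : ℂ) := by
        rw [← Complex.ofReal_mul, abs_mul_abs_self, Complex.ofReal_mul]
      simpa [sq] using e
    rw [h3, integral_complex_ofReal] at h2
    rw [← integral_Ioc_eq_integral_Ioo]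
    push_cast
    exact h2.symm
  have h4 : ‖UU u t‖ ^ 2 = ∫ x in Ioo (0:ℝ) 1, u x t ^ 2 := by exact_mod_cast h1
  rw [← h4, Real.sqrt_sq (norm_nonneg _)]

lemma scalar {X U ε D B K : ℝ} (hXU : X ≤ U) (hε : 0 ≤ ε) (hUD : U ≤ D) (hU : 0 ≤ U) (hB : 1 < B)
    (hK : 1 ≤ K) (hX : ∀ n : ℕ, X ≤ K * (B ^ (n + 1) * ε + D * (1 / B) ^ (n + 1))) :
    X ≤ K * (B + 1) * √(D * ε) := by
  have hB0 : 0 < B := by linarith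
  have hD : 0 ≤ D := hU.trans hUD
  have hKB : 1 ≤ K * (B + 1) := one_le_mul_of_one_le_of_one_le hK (by linarith)
  rcases hε.eq_or_lt with h0 | hε
  · subst h0
    rw [mul_zero, Real.sqrt_zero, mul_zero]
    have hlim : Filter.Tendsto (fun n : ℕ => K * (B ^ (n + 1) * 0 + D * (1 / B) ^ (n + 1)))
        Filter.atTop (nhds (K * (0 + D * 0))) := by
      have h1 : Filter.Tendsto (fun n : ℕ => (1 / B) ^ (n + 1)) Filter.atTop (nhds 0) := by
        refine (tendsto_pow_atTop_nhds_zero_of_lt_one (by positivity) ?_).comp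
          (Filter.tendsto_add_atTop_nat 1)
        rw [div_lt_one hB0]; exact hB
      simp only [mul_zero]
      simpa using (h1.const_mul D).const_mul K
    have := ge_of_tendsto' hlim hX
    simpa using this
  rcases le_total D ε with hDε | hDε
  · have h1 : U ≤ √(D * ε) := by
      refine Real.le_sqrt_of_sq_le ?_
      rw [sq]
      exact mul_le_mul hUD (hUD.trans hDε) hU hD
    have h2 : 0 ≤ √(D * ε) := Real.sqrt_nonneg _
    nlinarith
  have h1 : 1 ≤ D / ε := by rwa [one_le_div hε]
  obtain ⟨n, hn1, hn2⟩ := exists_nat_pow_near h1 (show 1 < B ^ 2 by nlinarith)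
  refine (hX n).trans ?_
  rw [mul_assoc]
  refine mul_le_mul_of_nonneg_left ?_ (by linarith)
  have h3 : B ^ n * ε ≤ √(D * ε) := by
    refine Real.le_sqrt_of_sq_le ?_
    rw [le_div_iff₀ hε] at hn1
    calc (B ^ n * ε) ^ 2 = ((B ^ 2) ^ n * ε) * ε := by rw [← pow_mul, mul_comm 2 n, pow_mul]; ring
      _ ≤ _ := mul_le_mul_of_nonneg_right hn1 hε.le
  have h4 : D * (1 / B) ^ (n + 1) ≤ √(D * ε) := by
    refine Real.le_sqrt_of_sq_le ?_
    rw [div_lt_iff₀ hε] at hn2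
    have : (D * (1 / B) ^ (n + 1)) ^ 2 = D * (D / (B ^ 2) ^ (n + 1)) := by
      rw [← pow_mul, mul_comm 2, pow_mul, one_div, inv_pow]; field_simp
    rw [this]
    refine mul_le_mul_of_nonneg_left ?_ hD
    rw [div_le_iff₀ (by positivity), mul_comm]
    exact hn2.le
  have h5 : B ^ (n + 1) * ε = B * (B ^ n * ε) := by ring
  rw [h5, add_mul, one_mul]
  exact add_le_add (mul_le_mul_of_nonneg_left h3 hB0.le) h4

lemma split_norm {f : ℝ → ℝ} {κ W : ℝ} (hf : ContinuousOn f (Icc 0 1)) (hκ : κ ∈ Ioo (0:ℝ) 1)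
    (hW : 0 ≤ W) (h : ∀ x ∈ Icc κ 1, |f x| ≤ W) :
    √(∫ x in Ioo (0:ℝ) 1, f x ^ 2) ≤ √(∫ x in Ioo (0:ℝ) κ, f x ^ 2) + W := by
  have hi : IntegrableOn (fun x => f x ^ 2) (Icc 0 1) :=
    (hf.pow 2).integrableOn_compact isCompact_Icc
  have e : Ioo (0:ℝ) 1 = Ioo 0 κ ∪ Ico κ 1 := (Ioo_union_Ico_eq_Ioo hκ.1 hκ.2.le).symm
  have hd : Disjoint (Ioo (0:ℝ) κ) (Ico κ 1) :=
    Set.disjoint_left.2 fun x hx hx2 => absurd hx.2 (not_lt.2 hx2.1)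
  have i1 : IntegrableOn (fun x => f x ^ 2) (Ioo 0 κ) :=
    hi.mono_set fun x hx => ⟨hx.1.le, (hx.2.trans hκ.2).le⟩
  have i2 : IntegrableOn (fun x => f x ^ 2) (Ico κ 1) :=
    hi.mono_set fun x hx => ⟨hκ.1.le.trans hx.1, hx.2.le⟩
  have h2 : ∫ x in Ico κ 1, f x ^ 2 ≤ W ^ 2 := by
    have h3 : ∫ x in Ico κ 1, f x ^ 2 ≤ ∫ x in Ico κ 1, W ^ 2 := by
      refine setIntegral_mono_on i2 (by simp) measurableSet_Ico fun x hx => ?_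
      exact sq_le_sq' (by linarith [(abs_le.1 (h x ⟨hx.1, hx.2.le⟩)).1])
        (abs_le.1 (h x ⟨hx.1, hx.2.le⟩)).2
    rw [setIntegral_const, Real.volume_real_Ico_of_le hκ.2.le, smul_eq_mul] at h3
    have := hκ.1
    nlinarith [sq_nonneg W]
  have hS : 0 ≤ ∫ x in Ioo (0:ℝ) κ, f x ^ 2 := integral_nonneg fun _ => sq_nonneg _
  rw [e, setIntegral_union hd measurableSet_Ico i1 i2]
  refine Real.sqrt_le_iff.2 ⟨by positivity, ?_⟩
  have h6 := Real.sq_sqrt hS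
  have h7 := Real.sqrt_nonneg (∫ x in Ioo (0:ℝ) κ, f x ^ 2)
  nlinarith

end DegRobin

open DegRobin

/-- Observability estimate at one point in time for the degenerate Robin problem. -/
theorem observability_at_one_time (α β₀ β₁ κ : ℝ) (hα : α ∈ Ioo (0:ℝ) 1)
    (hββ : β₀ * β₁ ≥ 0) (hβ₁ : β₁ ≠ 0) (hκ : κ ∈ Ioo (0:ℝ) 1) :
    ∃ C > (0:ℝ), ∃ ρ ∈ Ioo (0:ℝ) 1, ∀ T > (0:ℝ), ∀ τ ∈ Ioo (0:ℝ) T,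
      ∀ u v : ℝ → ℝ → ℝ, IsDegRobinSol α β₀ β₁ T u v →
        (∫ x in Ioo (0:ℝ) 1, (u x T) ^ 2) ^ ((1:ℝ)/2)
          ≤ (Real.exp (C * (1 + 1 / (T - τ)))
                * (∫ x in Ioo (0:ℝ) κ, (u x T) ^ 2) ^ ((1:ℝ)/2)) ^ ρ
              * ((∫ x in Ioo (0:ℝ) 1, (u x 0) ^ 2) ^ ((1:ℝ)/2)) ^ (1 - ρ) := by
  have h1α : 0 < 1 - α := by linarith [hα.2]
  obtain ⟨g, hg, hgd⟩ : ∃ g : ℝ, 0 ≤ g ∧ g * (1 - α) = β₀ / β₁ := by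
    refine ⟨β₀ / β₁ / (1 - α), div_nonneg ?_ h1α.le, by field_simp⟩
    have : β₀ / β₁ = β₀ * β₁ / β₁ ^ 2 := by field_simp
    rw [this]; positivity
  obtain ⟨B, hB, K1, hK1, hprop⟩ := prop_small hκ
  have hB0 : 0 < B := by linarith
  have hκ2 : κ / 2 ∈ Ioo (0:ℝ) 1 := ⟨by linarith [hκ.1], by linarith [hκ.1, hκ.2]⟩
  set q := 1 / B ^ 2 with hq
  have hq0 : 0 < q := by positivity
  have hq1 : q ≤ 1 := by rw [hq, div_le_one (by positivity)]; nlinarith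
  set E := Real.exp (-Real.log (κ / 2) / q) with hE
  have hE0 : 0 < E := Real.exp_pos _
  set K := 2 / (1 - α) with hK
  have hK2 : 1 ≤ K := by rw [hK, one_le_div h1α]; linarith [hα.1]
  set A := K * (1 + g) * (E + 1) with hA
  have hA1 : 1 ≤ A := one_le_mul_of_one_le_of_one_le
    (one_le_mul_of_one_le_of_one_le hK2 (by linarith)) (by linarith)
  set K3 := (K1 + 1) * (B + 1) with hK3
  have hK31 : 1 ≤ K3 := one_le_mul_of_one_le_of_one_le (by linarith) (by linarith)
  have hK3A : 1 ≤ K3 ^ 2 * A := one_le_mul_of_one_le_of_one_le (one_le_pow₀ hK31) hA1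
  set l := Real.log (K3 ^ 2 * A) with hl
  have hl0 : 0 ≤ l := Real.log_nonneg hK3A
  refine ⟨l + (1 + 2 * E ^ 2), by positivity, 1 / 2, ⟨by norm_num, by norm_num⟩, ?_⟩
  intro T hT τ hτ u v h
  obtain ⟨hXU, β, hβ, hJ⟩ := main_exp hα hβ₁ hg hgd hT h
  have hTm : T ∈ Icc 0 T := ⟨hT.le, le_rfl⟩
  have h0m : (0:ℝ) ∈ Icc 0 T := ⟨le_rfl, hT.le⟩
  set f : ℝ → ℝ := fun x => u x T with hf
  have hfc : ContinuousOn f (Icc 0 1) :=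
    h.cont_u.comp (f := fun x => (x, T)) (by fun_prop) fun x hx => ⟨hx, hTm⟩
  set U := ‖UU u 0‖ with hU
  have hU0 : 0 ≤ U := norm_nonneg _
  set Z := Real.exp ((1 + 2 * E ^ 2) / T) with hZ
  have hZ1 : 1 ≤ Z := Real.one_le_exp (by positivity)
  set ε := √(∫ x in Ioo (0:ℝ) κ, f x ^ 2) with hε
  have hε0 : 0 ≤ ε := Real.sqrt_nonneg _
  have hD0 : 0 ≤ A * Z * U := by positivity
  have hUD : U ≤ A * Z * U :=
    le_mul_of_one_le_left hU0 (one_le_mul_of_one_le_of_one_le hA1 hZ1)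
  have hmain : ∀ n : ℕ, ‖UU u T‖ ≤ (K1 + 1) * (B ^ (n + 1) * ε + A * Z * U * (1 / B) ^ (n + 1)) := by
    intro n
    obtain ⟨p, hpd, hp⟩ := poly_approx hα hg hT hκ2 hq0 hq1 hU0 (by linarith) f β hβ hJ (n + 1)
    have h1 := hprop f hfc n (A * Z * U) hD0 ⟨p, hpd, fun x hx => by
      refine (hp x hx).trans (le_of_eq ?_)
      rw [← hE, ← hA, ← hZ]; ring⟩
    rw [UU_norm h hTm]
    refine (split_norm hfc hκ (by positivity) h1).trans ?_
    rw [← hε]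
    have h2 : ε ≤ B ^ (n + 1) * ε := le_mul_of_one_le_left hε0 (one_le_pow₀ hB.le)
    have h3 : 0 ≤ A * Z * U * (1 / B) ^ (n + 1) := by positivity
    linarith
  have hfin := scalar hXU hε0 hUD hU0 hB (by linarith) hmain
  rw [← hK3] at hfin
  rw [UU_norm h hTm] at hfin
  have hU' := UU_norm h h0m
  rw [← hU] at hU'
  rw [show (1:ℝ) - 1 / 2 = 1 / 2 by norm_num, ← Real.sqrt_eq_rpow, ← Real.sqrt_eq_rpow,
    ← Real.sqrt_eq_rpow, ← Real.sqrt_eq_rpow, ← Real.sqrt_eq_rpow, ← hU', ← Real.sqrt_mul (by positivity)]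
  refine hfin.trans ?_
  refine Real.le_sqrt_of_sq_le ?_
  rw [mul_pow, Real.sq_sqrt (by positivity)]
  have hexp : K3 ^ 2 * A * Z ≤ Real.exp ((l + (1 + 2 * E ^ 2)) * (1 + 1 / (T - τ))) := by
    have e1 : K3 ^ 2 * A = Real.exp l := (Real.exp_log (by linarith)).symm
    rw [e1, hZ, ← Real.exp_add]
    refine Real.exp_le_exp.2 ?_
    have h1 : 1 / T ≤ 1 / (T - τ) := one_div_le_one_div_of_le (by linarith [hτ.2]) (by linarith [hτ.1])
    have h2 : 0 < 1 / T := by positivity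
    rw [div_eq_mul_one_div]
    have h3 : 0 ≤ 1 + 2 * E ^ 2 := by positivity
    have h4 : 0 ≤ l * (1 / (T - τ)) := mul_nonneg hl0 (by linarith)
    nlinarith
  calc K3 ^ 2 * (A * Z * U * ε) = K3 ^ 2 * A * Z * (ε * U) := by ring
    _ ≤ _ * (ε * U) := mul_le_mul_of_nonneg_right hexp (by positivity)
    _ = _ := by ring
end

section
/- Let α ∈ (0,1), let β₀, β₁ ∈ ℝ satisfy β₀·β₁ ≥ 0 and β₁ ≠ 0, let T > 0, and let u be a classical solution of the degenerate Robin problem on (0,1)×(0,T). Then the map t ↦ ∫₀¹ u(x,t)² dx is antitone (non-increasing) on [0,T]. -/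
open MeasureTheory Set

/-- The squared `L²` norm of a classical solution of the degenerate Robin problem
is non-increasing in time. -/
theorem energy_antitone (α β₀ β₁ T : ℝ) (hα : α ∈ Ioo (0:ℝ) 1)
    (hββ : β₀ * β₁ ≥ 0) (hβ₁ : β₁ ≠ 0) (hT : 0 < T)
    (u v : ℝ → ℝ → ℝ) (hu : IsDegRobinSol α β₀ β₁ T u v) :
    AntitoneOn (fun t => ∫ x in Ioo (0:ℝ) 1, (u x t) ^ 2) (Icc 0 T) := by
  have hcontx : ∀ t ∈ Icc (0:ℝ) T, ContinuousOn (fun x => u x t) (Icc 0 1) := by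
    intro t ht
    exact hu.cont_u.comp (f := fun x : ℝ => (x, t)) (by fun_prop) (fun x hx => ⟨hx, ht⟩)
  have hcontv : ∀ t ∈ Icc (0:ℝ) T, ContinuousOn (fun x => v x t) (Icc 0 1) := by
    intro t ht
    exact hu.cont_v.comp (f := fun x : ℝ => (x, t)) (by fun_prop) (fun x hx => ⟨hx, ht⟩)
  have hcontt : ∀ x ∈ Icc (0:ℝ) 1, ContinuousOn (fun t => u x t) (Icc 0 T) := by
    intro x hx
    exact hu.cont_u.comp (f := fun t : ℝ => (x, t)) (by fun_prop) (fun t ht => ⟨hx, ht⟩)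
  have hE : ContinuousOn (fun t => ∫ x in Ioo (0:ℝ) 1, (u x t) ^ 2) (Icc 0 T) := by
    obtain ⟨C, hC⟩ := (isCompact_Icc.prod isCompact_Icc).exists_bound_of_continuousOn
      (hu.cont_u.pow 2)
    refine continuousOn_of_dominated (bound := fun _ => C)
      (fun t ht => (hu.int_u t ht).aestronglyMeasurable) ?_ (by simp) ?_
    · intro t ht
      filter_upwards [ae_restrict_mem measurableSet_Ioo] with x hx
      exact hC (x, t) ⟨Ioo_subset_Icc_self hx, ht⟩
    · filter_upwards [ae_restrict_mem measurableSet_Ioo] with x hx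
      exact (hcontt x (Ioo_subset_Icc_self hx)).pow 2
  refine antitoneOn_of_deriv_nonpos (convex_Icc 0 T) hE ?_ ?_
  · rw [interior_Icc]
    intro t ht
    exact (hu.deriv_energy t ht).differentiableAt.differentiableWithinAt
  rw [interior_Icc]
  intro t ht
  rw [(hu.deriv_energy t ht).deriv]
  have htI := Ioo_subset_Icc_self ht
  by_cases hint : IntegrableOn (fun x => 2 * u x t * deriv (fun s => u x s) t) (Ioo 0 1)
  swap
  · rw [integral_undef hint]
  have hux := hu.int_ux t htI
  have hsum := hint.add (hux.const_mul 2)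
  have key := intervalIntegral.integral_eq_sub_of_hasDerivAt_of_le (zero_le_one' ℝ)
    (f := fun x => 2 * (u x t * v x t))
    (f' := fun x => 2 * u x t * deriv (fun s => u x s) t
      + 2 * (x ^ α * (deriv (fun y => u y t) x) ^ 2))
    (((hcontx t htI).mul (hcontv t htI)).const_mul 2)
    (by
      intro x hx
      have h1 : HasDerivAt (fun y => u y t) (deriv (fun y => u y t) x) x :=
        (((hu.contDiff_x t htI).differentiableOn (by norm_num)).differentiableAt
          (isOpen_Ioo.mem_nhds hx)).hasDerivAt
      have h2 := (hu.diff_v t htI x hx).hasDerivAt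
      have h3 := (h1.mul h2).const_mul 2
      refine HasDerivAt.congr_deriv h3 ?_
      rw [hu.pde x hx t ht, hu.v_eq t htI x hx]
      ring)
    ((intervalIntegrable_iff_integrableOn_Ioo_of_le zero_le_one).2 hsum)
  rw [intervalIntegral.integral_of_le zero_le_one, integral_Ioc_eq_integral_Ioo,
    integral_add hint (hux.const_mul 2), hu.dirichlet t htI] at key
  have hpos : 0 ≤ ∫ x in Ioo (0:ℝ) 1, 2 * (x ^ α * (deriv (fun y => u y t) x) ^ 2) := by
    refine setIntegral_nonneg measurableSet_Ioo (fun x hx => ?_)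
    have := Real.rpow_nonneg hx.1.le α
    positivity
  have hb : 0 ≤ u 0 t * v 0 t := by
    have hr := hu.robin t htI
    have h4 : 0 < β₁ ^ 2 := by positivity
    have h5 : β₁ ^ 2 * (u 0 t * v 0 t) = (β₀ * β₁) * (u 0 t) ^ 2 := by
      linear_combination (-β₁ * u 0 t) * hr
    have h6 : 0 ≤ β₁ ^ 2 * (u 0 t * v 0 t) := by
      rw [h5]; exact mul_nonneg hββ (sq_nonneg _)
    exact nonneg_of_mul_nonneg_right h6 h4
  linarith
end

section
/- Let T > 0, h > 0, C₀ ∈ (0,1), and set θ(t) := T − t + h. Let F, N : [0,T] → ℝ be continuous, with F(t) > 0 for all t ∈ [0,T], both differentiable on (0,T), and suppose F′(t) = −2·N(t)·F(t) and N′(t) ≤ ((1 + C₀)/θ(t))·N(t) for every t ∈ (0,T). Then for all 0 < t₁ < t₂ < t₃ ≤ T one has F(t₂)^{1+M} ≤ F(t₁)^{M} · F(t₃), where M = (∫_{t₂}^{t₃} θ(t)^{−(1+C₀)} dt) / (∫_{t₁}^{t₂} θ(t)^{−(1+C₀)} dt). -/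
open Set intervalIntegral

/-- Logarithmic convexity interpolation lemma obtained by solving the system of
ordinary differential inequalities `(1/2)F′ + N·F = 0`, `N′ ≤ ((1+C₀)/θ)·N`. -/
theorem log_convexity_interpolation (T h C₀ : ℝ) (hT : 0 < T) (hh : 0 < h)
    (hC₀ : C₀ ∈ Ioo (0:ℝ) 1) (F N : ℝ → ℝ)
    (hFcont : ContinuousOn F (Icc 0 T)) (hNcont : ContinuousOn N (Icc 0 T))
    (hFpos : ∀ t ∈ Icc (0:ℝ) T, 0 < F t)
    (hF' : ∀ t ∈ Ioo (0:ℝ) T, HasDerivAt F (-2 * N t * F t) t)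
    (hNdiff : ∀ t ∈ Ioo (0:ℝ) T, DifferentiableAt ℝ N t)
    (hN' : ∀ t ∈ Ioo (0:ℝ) T, deriv N t ≤ (1 + C₀) / (T - t + h) * N t) :
    ∀ t₁ t₂ t₃ : ℝ, 0 < t₁ → t₁ < t₂ → t₂ < t₃ → t₃ ≤ T →
      F t₂ ^ (1 + (∫ t in t₂..t₃, (T - t + h) ^ (-(1 + C₀)))
            / (∫ t in t₁..t₂, (T - t + h) ^ (-(1 + C₀))))
        ≤ F t₁ ^ ((∫ t in t₂..t₃, (T - t + h) ^ (-(1 + C₀)))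
            / (∫ t in t₁..t₂, (T - t + h) ^ (-(1 + C₀)))) * F t₃ := by
  intro t₁ t₂ t₃ h1 h12 h23 h3
  obtain ⟨hC0, hC1⟩ := hC₀
  have hθ : ∀ t, t ≤ T → 0 < T - t + h := fun t ht => by linarith
  have hθd : ∀ t : ℝ, HasDerivAt (fun s => T - s + h) (-1) t := fun t =>
    ((hasDerivAt_id t).const_sub T).add_const h
  have hΦd : ∀ t, t ≤ T → HasDerivAt (fun s => (T - s + h) ^ (-C₀) / C₀)
      ((T - t + h) ^ (-(1 + C₀))) t := by
    intro t ht
    have := ((hθd t).rpow_const (p := -C₀) (Or.inl (hθ t ht).ne')).div_const C₀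
    refine this.congr_deriv ?_
    rw [show -(1 + C₀) = -C₀ - 1 by ring]
    field_simp
  have hint : ∀ a b, a ≤ b → b ≤ T → ∫ t in a..b, (T - t + h) ^ (-(1 + C₀)) =
      (T - b + h) ^ (-C₀) / C₀ - (T - a + h) ^ (-C₀) / C₀ := by
    intro a b hab hb
    refine integral_eq_sub_of_hasDerivAt (f := fun s => (T - s + h) ^ (-C₀) / C₀) ?_ ?_
    · intro t ht
      rw [uIcc_of_le hab] at ht
      exact hΦd t (ht.2.trans hb)
    · apply ContinuousOn.intervalIntegrable
      rw [uIcc_of_le hab]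
      intro t ht
      exact (((hθd t).rpow_const (p := -(1 + C₀))
        (Or.inl (hθ t (ht.2.trans hb)).ne')).continuousAt).continuousWithinAt
  have hG : AntitoneOn (fun t => N t * (T - t + h) ^ (1 + C₀)) (Icc 0 T) := by
    have hd : ∀ t ∈ Ioo (0:ℝ) T, HasDerivAt (fun t => N t * (T - t + h) ^ (1 + C₀))
        (deriv N t * (T - t + h) ^ (1 + C₀) + N t * (-1 * (1 + C₀) * (T - t + h) ^ (1 + C₀ - 1))) t := by
      intro t ht
      exact (hNdiff t ht).hasDerivAt.mul
        ((hθd t).rpow_const (p := 1 + C₀) (Or.inl (hθ t ht.2.le).ne'))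
    apply antitoneOn_of_deriv_nonpos (convex_Icc 0 T)
    · apply hNcont.mul
      intro t ht
      exact (((hθd t).rpow_const (p := 1 + C₀)
        (Or.inl (hθ t ht.2).ne')).continuousAt).continuousWithinAt
    · rw [interior_Icc]
      exact fun t ht => (hd t ht).differentiableAt.differentiableWithinAt
    · rw [interior_Icc]
      intro t ht
      rw [(hd t ht).deriv]
      have hp := hθ t ht.2.le
      have := mul_le_mul_of_nonneg_right (hN' t ht) (Real.rpow_nonneg hp.le (1 + C₀))
      rw [Real.rpow_sub_one hp.ne']
      have e : (1 + C₀) / (T - t + h) * N t * (T - t + h) ^ (1 + C₀)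
        = - (N t * (-1 * (1 + C₀) * ((T - t + h) ^ (1 + C₀) / (T - t + h)))) := by ring
      linarith
  set c := N t₂ * (T - t₂ + h) ^ (1 + C₀) with hc
  have hNe : ∀ t, t ≤ T → N t = (N t * (T - t + h) ^ (1 + C₀)) * (T - t + h) ^ (-(1 + C₀)) := by
    intro t ht
    rw [mul_assoc, ← Real.rpow_add (hθ t ht)]
    simp
  have hHd : ∀ t ∈ Ioo (0:ℝ) T,
      HasDerivAt (fun t => Real.log (F t) + 2 * c * ((T - t + h) ^ (-C₀) / C₀))
        (-2 * N t + 2 * c * (T - t + h) ^ (-(1 + C₀))) t := by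
    intro t ht
    have hp := hFpos t ⟨ht.1.le, ht.2.le⟩
    have := ((hF' t ht).log hp.ne').add ((hΦd t ht.2.le).const_mul (2 * c))
    refine this.congr_deriv ?_
    field_simp
  have hHc : ContinuousOn (fun t => Real.log (F t) + 2 * c * ((T - t + h) ^ (-C₀) / C₀))
      (Icc 0 T) := by
    refine (hFcont.log fun t ht => (hFpos t ht).ne').add ?_
    intro t ht
    exact ((hΦd t ht.2).const_mul (2 * c)).continuousAt.continuousWithinAt
  have hm : MonotoneOn (fun t => Real.log (F t) + 2 * c * ((T - t + h) ^ (-C₀) / C₀))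
      (Icc t₂ t₃) := by
    have hsub : ∀ t ∈ Ioo t₂ t₃, t ∈ Ioo 0 T := fun t ht => ⟨by linarith [ht.1], by linarith [ht.2]⟩
    apply monotoneOn_of_deriv_nonneg (convex_Icc _ _)
    · exact hHc.mono (Icc_subset_Icc (by linarith) h3)
    · rw [interior_Icc]
      exact fun t ht => (hHd t (hsub t ht)).differentiableAt.differentiableWithinAt
    · rw [interior_Icc]
      intro t ht
      have ht' := hsub t ht
      rw [(hHd t ht').deriv]
      have h5 := hG ⟨by linarith, by linarith⟩ ⟨ht'.1.le, ht'.2.le⟩ ht.1.le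
      have := mul_le_mul_of_nonneg_right h5 (Real.rpow_nonneg (hθ t ht'.2.le).le (-(1 + C₀)))
      simp only at this
      rw [← hNe t ht'.2.le, ← hc] at this
      linarith
  have ha : AntitoneOn (fun t => Real.log (F t) + 2 * c * ((T - t + h) ^ (-C₀) / C₀))
      (Icc t₁ t₂) := by
    have hsub : ∀ t ∈ Ioo t₁ t₂, t ∈ Ioo 0 T := fun t ht => ⟨by linarith [ht.1], by linarith [ht.2]⟩
    apply antitoneOn_of_deriv_nonpos (convex_Icc _ _)
    · exact hHc.mono (Icc_subset_Icc (by linarith) (by linarith))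
    · rw [interior_Icc]
      exact fun t ht => (hHd t (hsub t ht)).differentiableAt.differentiableWithinAt
    · rw [interior_Icc]
      intro t ht
      have ht' := hsub t ht
      rw [(hHd t ht').deriv]
      have h5 := hG ⟨ht'.1.le, ht'.2.le⟩ ⟨by linarith, by linarith⟩ ht.2.le
      have := mul_le_mul_of_nonneg_right h5 (Real.rpow_nonneg (hθ t ht'.2.le).le (-(1 + C₀)))
      simp only at this
      rw [← hNe t ht'.2.le, ← hc] at this
      linarith
  have hm' := hm (left_mem_Icc.2 h23.le) (right_mem_Icc.2 h23.le) h23.le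
  have ha' := ha (left_mem_Icc.2 h12.le) (right_mem_Icc.2 h12.le) h12.le
  simp only at hm' ha'
  have hΦlt : ∀ a b, a < b → b ≤ T → (T - a + h) ^ (-C₀) / C₀ < (T - b + h) ^ (-C₀) / C₀ := by
    intro a b hab hb
    apply div_lt_div_of_pos_right _ hC0
    exact Real.rpow_lt_rpow_of_neg (hθ b hb) (by linarith) (by linarith)
  have hA := hΦlt t₁ t₂ h12 (by linarith)
  have hB := hΦlt t₂ t₃ h23 h3
  rw [hint t₁ t₂ h12.le (by linarith), hint t₂ t₃ h23.le h3]
  generalize (T - t₁ + h) ^ (-C₀) / C₀ = p₁ at *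
  generalize (T - t₂ + h) ^ (-C₀) / C₀ = p₂ at *
  generalize (T - t₃ + h) ^ (-C₀) / C₀ = p₃ at *
  have hF1 := hFpos t₁ ⟨by linarith, by linarith⟩
  have hF2 := hFpos t₂ ⟨by linarith, by linarith⟩
  have hF3 := hFpos t₃ ⟨by linarith, by linarith⟩
  have hM : 0 < (p₃ - p₂) / (p₂ - p₁) := div_pos (by linarith) (by linarith)
  have hMe : (p₃ - p₂) / (p₂ - p₁) * (p₂ - p₁) = p₃ - p₂ :=
    div_mul_cancel₀ _ (by linarith)
  generalize (p₃ - p₂) / (p₂ - p₁) = M at *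
  rw [← Real.log_le_log_iff (Real.rpow_pos_of_pos hF2 _)
    (mul_pos (Real.rpow_pos_of_pos hF1 _) hF3),
    Real.log_mul (Real.rpow_pos_of_pos hF1 _).ne' hF3.ne', Real.log_rpow hF2, Real.log_rpow hF1]
  have k1 : M * (Real.log (F t₂) - Real.log (F t₁)) ≤ M * (-2 * c * (p₂ - p₁)) :=
    mul_le_mul_of_nonneg_left (by linarith) hM.le
  have k2 : M * (-2 * c * (p₂ - p₁)) = -2 * c * (p₃ - p₂) := by rw [← hMe]; ring
  linarith
end

section
/- Let H, G, U be real Hilbert spaces, let A : H → G and B : H → U be continuous linear maps, and let K, ε > 0. Assume the observability inequality: for every v ∈ H, ‖A v‖² ≤ K²·‖B v‖² + ε²·‖v‖². Then for every g ∈ G there exists u ∈ U such that ‖u‖ ≤ K·‖g‖ and ‖A* g + B* u‖ ≤ ε·‖g‖, where A* : G → H and B* : U → H are the Hilbert-space adjoints. -/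
/-- Abstract duality principle: an ε-parametrized observability inequality for the
adjoint maps yields an approximate control with cost `K`. -/
theorem duality_control {H G U : Type*}
    [NormedAddCommGroup H] [InnerProductSpace ℝ H] [CompleteSpace H]
    [NormedAddCommGroup G] [InnerProductSpace ℝ G] [CompleteSpace G]
    [NormedAddCommGroup U] [InnerProductSpace ℝ U] [CompleteSpace U]
    (A : H →L[ℝ] G) (B : H →L[ℝ] U) (K ε : ℝ) (hK : 0 < K) (hε : 0 < ε)
    (hobs : ∀ v : H, ‖A v‖ ^ 2 ≤ K ^ 2 * ‖B v‖ ^ 2 + ε ^ 2 * ‖v‖ ^ 2) :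
    ∀ g : G, ∃ u : U, ‖u‖ ≤ K * ‖g‖ ∧
      ‖ContinuousLinearMap.adjoint A g + ContinuousLinearMap.adjoint B u‖ ≤ ε * ‖g‖ := by
  intro g
  set T : H →L[ℝ] H := (K ^ 2) • ((ContinuousLinearMap.adjoint B) ∘L B)
    + (ε ^ 2) • ContinuousLinearMap.id ℝ H with hT
  have hTi : ∀ v w : H, inner ℝ (T v) w = K ^ 2 * inner ℝ (B v) (B w) + ε ^ 2 * inner ℝ v w := by
    intro v w
    simp [hT, inner_add_left, real_inner_smul_left, ContinuousLinearMap.adjoint_inner_left]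
  have hc : IsCoercive ((innerSL ℝ : H →L[ℝ] H →L[ℝ] ℝ) ∘L T) := by
    refine ⟨ε ^ 2, by positivity, fun v => ?_⟩
    have h1 : ((innerSL ℝ : H →L[ℝ] H →L[ℝ] ℝ) ∘L T) v v = inner ℝ (T v) v := rfl
    rw [h1, hTi, real_inner_self_eq_norm_sq, real_inner_self_eq_norm_sq]
    nlinarith [mul_nonneg (sq_nonneg K) (sq_nonneg ‖B v‖)]
  obtain ⟨w, hw⟩ := hc.continuousLinearEquivOfBilin.surjective (ContinuousLinearMap.adjoint A g)
  have hTw : T w = ContinuousLinearMap.adjoint A g := by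
    refine ext_inner_right ℝ fun z => ?_
    rw [← hw, hc.continuousLinearEquivOfBilin_apply]
    rfl
  have hS := hTi w w
  rw [hTw, ContinuousLinearMap.adjoint_inner_left, real_inner_self_eq_norm_sq,
    real_inner_self_eq_norm_sq] at hS
  have hcs := real_inner_le_norm g (A w)
  have ho := hobs w
  have hAg : ‖A w‖ ≤ ‖g‖ := by
    by_contra! h
    nlinarith [norm_nonneg g, norm_nonneg (A w)]
  have hSg : K ^ 2 * ‖B w‖ ^ 2 + ε ^ 2 * ‖w‖ ^ 2 ≤ ‖g‖ ^ 2 := by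
    nlinarith [norm_nonneg g]
  have h1 : K * ‖B w‖ ≤ ‖g‖ := by
    refine le_of_abs_le (abs_le_of_sq_le_sq ?_ (norm_nonneg g))
    nlinarith [mul_nonneg (sq_nonneg ε) (sq_nonneg ‖w‖)]
  have h2 : ε * ‖w‖ ≤ ‖g‖ := by
    refine le_of_abs_le (abs_le_of_sq_le_sq ?_ (norm_nonneg g))
    nlinarith [mul_nonneg (sq_nonneg K) (sq_nonneg ‖B w‖)]
  refine ⟨-(K ^ 2 • B w), ?_, ?_⟩
  · rw [norm_neg, norm_smul, Real.norm_of_nonneg (by positivity)]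
    nlinarith
  · have : ContinuousLinearMap.adjoint A g + ContinuousLinearMap.adjoint B (-(K ^ 2 • B w))
        = ε ^ 2 • w := by
      rw [← hTw]; simp [hT]
    rw [this, norm_smul, Real.norm_of_nonneg (by positivity)]
    nlinarith
end

section
/- Let H, G, U be real Hilbert spaces, let A : H → G and B : H → U be continuous linear maps, let g ∈ G, and let K, ε > 0. Assume that for every v ∈ H, ‖A v‖² ≤ 2·K²·‖B v‖² + ε²·‖v‖². Define J : H → ℝ by J(v) = (K²/2)·‖B v‖² + (ε²/2)·‖v‖² + ⟪g, A v⟫. Then for every v ∈ H, J(v) ≥ (ε²/4)·‖v‖² − ‖g‖². -/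
open scoped RealInnerProductSpace

/-- Coercivity of the dual penalized functional `J` under the ε-parametrized
observability inequality. -/
theorem dual_functional_coercive {H G U : Type*}
    [NormedAddCommGroup H] [InnerProductSpace ℝ H] [CompleteSpace H]
    [NormedAddCommGroup G] [InnerProductSpace ℝ G] [CompleteSpace G]
    [NormedAddCommGroup U] [InnerProductSpace ℝ U] [CompleteSpace U]
    (A : H →L[ℝ] G) (B : H →L[ℝ] U) (g : G) (K ε : ℝ) (hK : 0 < K) (hε : 0 < ε)
    (hobs : ∀ v : H, ‖A v‖ ^ 2 ≤ 2 * K ^ 2 * ‖B v‖ ^ 2 + ε ^ 2 * ‖v‖ ^ 2) :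
    ∀ v : H,
      (K ^ 2 / 2) * ‖B v‖ ^ 2 + (ε ^ 2 / 2) * ‖v‖ ^ 2 + ⟪g, A v⟫
        ≥ (ε ^ 2 / 4) * ‖v‖ ^ 2 - ‖g‖ ^ 2 := by
  intro v
  have h1 := hobs v
  have h2 := (abs_le.mp (abs_real_inner_le_norm g (A v))).1
  nlinarith [sq_nonneg (‖g‖ - ‖A v‖ / 2)]
end

section
/- Let X, c, G be nonnegative reals with X ≤ c, and let M > 0, C₁ > 0, C₂ > 0, D ≥ 1. Assume that for every h > 0: X^{1+M} ≤ e^{C₁/h}·c^{M}·G + D·e^{−C₂/h}·c^{1+M}. Then X^{(1+M)(1+C₁/C₂)} ≤ 2^{1+C₁/C₂}·D^{C₁/C₂}·c^{M + (1+M)·C₁/C₂}·G. -/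
/-- Optimization-in-`h` step: the family of interpolation inequalities parametrized
by `h > 0` yields a single Hölder-type observation estimate. -/
theorem optimize_in_h (X c G M C₁ C₂ D : ℝ) (hX : 0 ≤ X) (hc : 0 ≤ c) (hG : 0 ≤ G)
    (hXc : X ≤ c) (hM : 0 < M) (hC₁ : 0 < C₁) (hC₂ : 0 < C₂) (hD : 1 ≤ D)
    (h : ∀ h : ℝ, 0 < h →
      X ^ (1 + M) ≤ Real.exp (C₁ / h) * c ^ M * G
        + D * Real.exp (-C₂ / h) * c ^ (1 + M)) :
    X ^ ((1 + M) * (1 + C₁ / C₂))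
      ≤ 2 ^ (1 + C₁ / C₂) * D ^ (C₁ / C₂) * c ^ (M + (1 + M) * (C₁ / C₂)) * G := by
  rcases hX.eq_or_lt with h0 | hX0
  · subst h0
    rw [Real.zero_rpow (by positivity)]
    positivity
  have hc0 : 0 < c := lt_of_lt_of_le hX0 hXc
  have hD0 : 0 < D := by linarith
  have hYK : X ^ (1 + M) ≤ c ^ (1 + M) := Real.rpow_le_rpow hX hXc (by linarith)
  rw [Real.rpow_mul hX, Real.rpow_add hc0, Real.rpow_mul hc]
  have hY : 0 < X ^ (1 + M) := Real.rpow_pos_of_pos hX0 _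
  have hK : 0 < c ^ (1 + M) := Real.rpow_pos_of_pos hc0 _
  generalize X ^ (1 + M) = Y at *
  generalize c ^ (1 + M) = K at *
  have hR : 1 < 2 * D * K / Y := by
    rw [lt_div_iff₀ hY]
    nlinarith
  have hR0 : 0 < 2 * D * K / Y := by positivity
  have hL : 0 < Real.log (2 * D * K / Y) := Real.log_pos hR
  have key := h (C₂ / Real.log (2 * D * K / Y)) (by positivity)
  have e1 : C₁ / (C₂ / Real.log (2 * D * K / Y)) = Real.log (2 * D * K / Y) * (C₁ / C₂) := by
    field_simp
  have e2 : -C₂ / (C₂ / Real.log (2 * D * K / Y)) = -Real.log (2 * D * K / Y) := by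
    field_simp
  rw [e1, e2, ← Real.rpow_def_of_pos hR0, Real.exp_neg, Real.exp_log hR0] at key
  have e3 : D * (2 * D * K / Y)⁻¹ * K = Y / 2 := by
    field_simp
  rw [e3, Real.div_rpow (by positivity) hY.le, Real.mul_rpow (by positivity) hK.le,
    Real.mul_rpow (by norm_num) hD0.le] at key
  rw [Real.rpow_add hY, Real.rpow_add (by norm_num : (0 : ℝ) < 2), Real.rpow_one, Real.rpow_one]
  have hYa : 0 < Y ^ (C₁ / C₂) := Real.rpow_pos_of_pos hY _
  generalize Y ^ (C₁ / C₂) = Z at *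
  have k2 : Y ≤ 2 * (2 ^ (C₁ / C₂) * D ^ (C₁ / C₂) * K ^ (C₁ / C₂) * c ^ M * G) / Z := by
    have : 2 * (2 ^ (C₁ / C₂) * D ^ (C₁ / C₂) * K ^ (C₁ / C₂) * c ^ M * G) / Z
      = 2 * (2 ^ (C₁ / C₂) * D ^ (C₁ / C₂) * K ^ (C₁ / C₂) / Z * c ^ M * G) := by ring
    rw [this]
    linarith
  rw [le_div_iff₀ hYa] at k2
  linarith
end
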